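/- arXiv:1909.04752 — 2 statements merged into one kernel-verified Lean document; each statement's English description precedes it below -/
import Mathlib

section
/- Let M ⊂ ℂ³ be given by w = ρ(z,z̄) = z̄₁z₂ + z̄₂³. Suppose f(z,z̄) is a real-analytic function defined near 0 ∈ ℂ² satisfying Lf = 0 near 0, where L = ρ_{z̄₂} ∂/∂z̄₁ − ρ_{z̄₁} ∂/∂z̄₂ = 3z̄₂² ∂/∂z̄₁ − z₂ ∂/∂z̄₂ (so f is CR on M). Then there exists a holomorphic function F on a neighborhood of 0 ∈ ℂ³ such that f(z,z̄) = F(z, z̄₁z₂ + z̄₂³) for all z in a neighborhood of 0 ∈ ℂ². (Note: the quadric model w = z̄₁z₂ of M fails the rank condition, so this extension is due to the cubic term.) -/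
open Filter Asymptotics Topology

/-- Pointwise application of a continuous multilinear map to continuous functions on a compact
space. -/
noncomputable def ContinuousMultilinearMap.compContinuousMap {𝕜 E F K ι : Type*}
    [NontriviallyNormedField 𝕜] [NormedAddCommGroup E] [NormedSpace 𝕜 E]
    [NormedAddCommGroup F] [NormedSpace 𝕜 F] [TopologicalSpace K] [CompactSpace K] [Fintype ι]
    (q : ContinuousMultilinearMap 𝕜 (fun _ : ι => E) F) :
    ContinuousMultilinearMap 𝕜 (fun _ : ι => C(K, E)) C(K, F) :=
  MultilinearMap.mkContinuous
    { toFun := fun φ => ⟨fun τ => q fun i => φ i τ, by fun_prop⟩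
      map_update_add' := by
        intro _ m i x y
        ext τ
        have key : ∀ z : C(K, E), (fun j => Function.update m i z j τ) =
            Function.update (fun j => m j τ) i (z τ) := fun z => by
          ext j
          by_cases h : j = i
          · subst h; simp
          · simp [h]
        simp [key]
      map_update_smul' := by
        intro _ m i c x
        ext τ
        have key : ∀ z : C(K, E), (fun j => Function.update m i z j τ) =
            Function.update (fun j => m j τ) i (z τ) := fun z => by
          ext j
          by_cases h : j = i
          · subst h; simp
          · simp [h]
        simp [key] }
    ‖q‖ fun φ => by
      refine (ContinuousMap.norm_le _ (by positivity)).2 fun τ => (q.le_opNorm _).trans ?_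
      gcongr with i
      exact (φ i).norm_coe_le_norm τ

/-- The superposition operator `φ ↦ f ∘ φ` on continuous functions is analytic at `0` when `f`
is. -/
lemma AnalyticAt.exists_superposition {𝕜 E F : Type*} (K : Type*)
    [NontriviallyNormedField 𝕜] [NormedAddCommGroup E] [NormedSpace 𝕜 E]
    [NormedAddCommGroup F] [NormedSpace 𝕜 F] [CompleteSpace F]
    [TopologicalSpace K] [CompactSpace K] {f : E → F} (hf : AnalyticAt 𝕜 f 0) :
    ∃ Φ : C(K, E) → C(K, F), AnalyticAt 𝕜 Φ 0 ∧ ∀ᶠ φ in 𝓝 0, ∀ τ, Φ φ τ = f (φ τ) := by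
  obtain ⟨p, r, hp⟩ := hf
  let P : FormalMultilinearSeries 𝕜 C(K, E) C(K, F) := fun n => (p n).compContinuousMap
  have hPn : ∀ n, ‖P n‖ ≤ ‖p n‖ := fun n =>
    MultilinearMap.mkContinuous_norm_le _ (norm_nonneg _) _
  have hrad : p.radius ≤ P.radius := ENNReal.le_of_forall_nnreal_lt fun s hs => by
    obtain ⟨C, -, hC⟩ := p.norm_mul_pow_le_of_lt_radius hs
    exact P.le_radius_of_bound C fun n => le_trans (by gcongr; exact hPn n) (hC n)
  have hpos : 0 < P.radius := hp.r_pos.trans_le (hp.r_le.trans hrad)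
  have hP := P.hasFPowerSeriesOnBall hpos
  refine ⟨P.sum, ⟨P, _, hP⟩, ?_⟩
  filter_upwards [Metric.eball_mem_nhds (0 : C(K, E)) hp.r_pos] with φ hφ τ
  have h1 := hP.hasSum (Metric.eball_subset_eball (hp.r_le.trans hrad) hφ)
  have h2 := h1.mapL (ContinuousMap.evalCLM 𝕜 τ)
  have hτ : φ τ ∈ Metric.eball (0 : E) r := by
    rw [Metric.mem_eball, edist_zero_right] at hφ ⊢
    refine lt_of_le_of_lt ?_ hφ
    rw [← ofReal_norm, ← ofReal_norm]
    exact ENNReal.ofReal_le_ofReal (φ.norm_coe_le_norm τ)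
  have h3 := hp.hasSum hτ
  rw [zero_add] at h2 h3
  exact h2.unique h3

/-- The contour integral over the circle of radius `r`, as a functional on continuous functions on
the unit circle. -/
noncomputable def circleIntegralCLM (r : ℝ) : C(Circle, ℂ) →L[ℂ] ℂ :=
  LinearMap.mkContinuous
    { toFun := fun φ => ∫ θ in (0)..(2 * Real.pi), deriv (circleMap 0 r) θ * φ (Circle.exp θ)
      map_add' := fun φ ψ => by
        rw [← intervalIntegral.integral_add]
        · simp [mul_add]
        all_goals
          apply Continuous.intervalIntegrable
          simp only [deriv_circleMap]
          fun_prop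
      map_smul' := fun c φ => by
        rw [RingHom.id_apply, smul_eq_mul, ← intervalIntegral.integral_const_mul]
        congr 1
        ext θ
        simp only [ContinuousMap.smul_apply, smul_eq_mul]
        ring }
    (|r| * |2 * Real.pi - 0|) fun φ => by
      refine (intervalIntegral.norm_integral_le_of_norm_le_const (C := |r| * ‖φ‖)
        fun θ _ => ?_).trans_eq (by ring)
      rw [norm_mul, deriv_circleMap, norm_mul, norm_circleMap_zero, Complex.norm_I, mul_one]
      gcongr
      exact φ.norm_coe_le_norm _

lemma circleIntegralCLM_apply (r : ℝ) (φ : C(Circle, ℂ)) (g : ℂ → ℂ)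
    (h : ∀ c : Circle, φ c = g (r * c)) : circleIntegralCLM r φ = ∮ τ in C(0, r), g τ := by
  change ∫ θ in (0)..(2 * Real.pi), deriv (circleMap 0 r) θ * φ (Circle.exp θ) = _
  simp only [circleIntegral, smul_eq_mul, h, circleMap_zero, Circle.coe_exp]

/-- Cauchy's formula for the average of `g` over the cube roots of `t ^ 3`. -/
lemma circleIntegral_cube_sub_inv {g : ℂ → ℂ} {r : ℝ} {t ω : ℂ} (hω : ω ^ 2 + ω + 1 = 0)
    (hg : DifferentiableOn ℂ g (Metric.closedBall 0 r)) (ht : ‖t‖ < r) :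
    (∮ τ in C(0, r), g τ * (τ ^ 2 * (τ ^ 3 - t ^ 3)⁻¹)) =
      2 * Real.pi * Complex.I * ((g t + g (ω * t) + g (ω ^ 2 * t)) / 3) := by
  have hr : 0 < r := (norm_nonneg t).trans_lt ht
  have hω3 : ω ^ 3 = 1 := by linear_combination (ω - 1) * hω
  have hωn : ‖ω‖ = 1 := Complex.norm_eq_one_of_pow_eq_one hω3 (by norm_num)
  have hmem : ∀ a : ℂ, ‖a‖ = 1 → a * t ∈ Metric.ball (0 : ℂ) r := fun a ha => by
    simpa [ha] using ht
  have hne : ∀ a : ℂ, ‖a‖ = 1 → ∀ τ ∈ Metric.sphere (0 : ℂ) r, τ - a * t ≠ 0 := by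
    intro a ha τ hτ h
    have h1 := hmem a ha
    rw [← sub_eq_zero.1 h] at h1
    simp only [mem_sphere_iff_norm, sub_zero, Metric.mem_ball, dist_zero_right] at hτ h1
    linarith
  have hint : ∀ a : ℂ, ‖a‖ = 1 → CircleIntegrable (fun τ => (τ - a * t)⁻¹ • g τ) 0 r := by
    intro a ha
    refine ContinuousOn.circleIntegrable hr.le (ContinuousOn.fun_smul ?_ ?_)
    · exact ContinuousOn.inv₀ (by fun_prop) (hne a ha)
    · exact hg.continuousOn.mono Metric.sphere_subset_closedBall
  have hval : ∀ a : ℂ, ‖a‖ = 1 → (∮ τ in C(0, r), (τ - a * t)⁻¹ • g τ) =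
      (2 * Real.pi * Complex.I) • g (a * t) := fun a ha =>
    hg.circleIntegral_sub_inv_smul (hmem a ha)
  have h1 : ‖(1 : ℂ)‖ = 1 := by simp
  have h2 : ‖ω ^ 2‖ = 1 := by simp [hωn]
  have hsum : (∮ τ in C(0, r), g τ * (τ ^ 2 * (τ ^ 3 - t ^ 3)⁻¹)) =
      ∮ τ in C(0, r), (3 : ℂ)⁻¹ • (((τ - 1 * t)⁻¹ • g τ + (τ - ω * t)⁻¹ • g τ) +
        (τ - ω ^ 2 * t)⁻¹ • g τ) := by
    refine circleIntegral.integral_congr hr.le fun τ hτ => ?_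
    have e1 := hne 1 h1 τ hτ
    have e2 := hne ω hωn τ hτ
    have e3 := hne (ω ^ 2) h2 τ hτ
    have hfac : τ ^ 3 - t ^ 3 = (τ - 1 * t) * (τ - ω * t) * (τ - ω ^ 2 * t) := by
      linear_combination (τ ^ 2 * t - t ^ 2 * τ * ω - t ^ 3 * (1 - ω)) * hω
    have hder : 3 * τ ^ 2 = (τ - ω * t) * (τ - ω ^ 2 * t) + (τ - 1 * t) * (τ - ω ^ 2 * t) +
        (τ - 1 * t) * (τ - ω * t) := by
      linear_combination (2 * τ * t - t ^ 2 * ω) * hω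
    have : τ ^ 2 = ((τ - ω * t) * (τ - ω ^ 2 * t) + (τ - 1 * t) * (τ - ω ^ 2 * t) +
        (τ - 1 * t) * (τ - ω * t)) / 3 := by rw [← hder]; ring
    simp only [smul_eq_mul]
    rw [hfac, this]
    generalize τ - 1 * t = A at *
    generalize τ - ω * t = B at *
    generalize τ - ω ^ 2 * t = D at *
    field_simp
  have hadd := (circleIntegral.integral_add (hint 1 h1) (hint ω hωn))
  rw [hsum, circleIntegral.integral_smul,
    circleIntegral.integral_add (by exact (hint 1 h1).add (hint ω hωn)) (hint _ h2), hadd,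
    hval 1 h1, hval ω hωn, hval _ h2]
  simp only [smul_eq_mul, one_mul]
  ring

/-- The average of `g (z, ·)` over the cube roots of `w` is an analytic function of `(z, w)`. -/
lemma AnalyticAt.exists_cubeRoot_average {E : Type*} [NormedAddCommGroup E] [NormedSpace ℂ E]
    {g : E × ℂ → ℂ} (hg : AnalyticAt ℂ g 0) {ω : ℂ} (hω : ω ^ 2 + ω + 1 = 0) :
    ∃ F : E × ℂ → ℂ, AnalyticAt ℂ F 0 ∧ ∀ᶠ p : E × ℂ in 𝓝 0,
      F (p.1, p.2 ^ 3) = (g (p.1, p.2) + g (p.1, ω * p.2) + g (p.1, ω ^ 2 * p.2)) / 3 := by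
  obtain ⟨Φ, hΦ, hval⟩ := hg.exists_superposition Circle
  obtain ⟨R, hR, hball⟩ := Metric.eventually_nhds_iff_ball.1
    (hΦ.eventually_analyticAt.and hval)
  obtain ⟨R', hR', hball'⟩ := Metric.eventually_nhds_iff_ball.1 hg.eventually_analyticAt
  obtain ⟨r, hr, hrlt⟩ := exists_between (lt_min hR hR')
  have hrR : r < R := hrlt.trans_le (min_le_left _ _)
  have hrR' : r < R' := hrlt.trans_le (min_le_right _ _)
  let τ : C(Circle, ℂ) := ⟨fun c => r * c, by fun_prop⟩
  let φ₀ : C(Circle, E × ℂ) := ⟨fun c => (0, r * c), by fun_prop⟩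
  let ψ : E →L[ℂ] C(Circle, E × ℂ) :=
    (ContinuousLinearMap.compLeftContinuous ℂ Circle (ContinuousLinearMap.inl ℂ E ℂ)).comp
      (ContinuousLinearMap.const ℂ Circle)
  have hφ : ∀ z c, (ψ z + φ₀) c = (z, (r * c : ℂ)) := fun z c => by
    simp [ψ, φ₀]
  have hφnorm : ∀ z : E, ‖z‖ < R → ψ z + φ₀ ∈ Metric.ball (0 : C(Circle, E × ℂ)) R := by
    intro z hz
    rw [mem_ball_zero_iff, ContinuousMap.norm_lt_iff _ hR]
    intro c
    rw [hφ, Prod.norm_def]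
    simpa [abs_of_pos hr, Circle.norm_coe] using ⟨hz, hrR⟩
  have hτ3 : IsUnit (τ ^ 3) := by
    rw [ContinuousMap.isUnit_iff_forall_ne_zero]
    intro c
    simp [τ, hr.ne']
  let F : E × ℂ → ℂ := fun p => (2 * Real.pi * Complex.I)⁻¹ *
    circleIntegralCLM r (Φ (ψ p.1 + φ₀) * (τ ^ 2 * Ring.inverse (τ ^ 3 - p.2 • 1)))
  refine ⟨F, ?_, ?_⟩
  · refine analyticAt_const.mul ((circleIntegralCLM r).analyticAt _ |>.comp ?_)
    refine AnalyticAt.mul ?_ (analyticAt_const.mul ?_)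
    · refine AnalyticAt.fun_comp (g := Φ) ?_ ?_
      · exact (hball _ (hφnorm _ (by simpa using hR))).1
      · exact ((ψ.analyticAt _).comp analyticAt_fst).add analyticAt_const
    · refine AnalyticAt.fun_comp (g := Ring.inverse) ?_ ?_
      · obtain ⟨u, hu⟩ := hτ3
        simpa [← hu] using analyticAt_inverse (𝕜 := ℂ) u
      · exact analyticAt_const.sub (analyticAt_snd.smul analyticAt_const)
  · filter_upwards [Metric.ball_mem_nhds (0 : E × ℂ) hr] with p hp
    obtain ⟨z, t⟩ := p
    rw [mem_ball_zero_iff, Prod.norm_def, max_lt_iff] at hp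
    obtain ⟨hz : ‖z‖ < r, ht : ‖t‖ < r⟩ := hp
    have hunit : IsUnit (τ ^ 3 - t ^ 3 • (1 : C(Circle, ℂ))) := by
      rw [ContinuousMap.isUnit_iff_forall_ne_zero]
      intro c h
      have h1 : (r * c : ℂ) ^ 3 = t ^ 3 := by simpa [τ, sub_eq_zero] using h
      have h2 : r ^ 3 = ‖t‖ ^ 3 := by simpa [abs_of_pos hr, Circle.norm_coe] using congrArg norm h1
      exact (pow_lt_pow_left₀ ht (norm_nonneg t) (by norm_num)).ne h2.symm
    have hinv : ∀ c, Ring.inverse (τ ^ 3 - t ^ 3 • (1 : C(Circle, ℂ))) c =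
        ((r * c : ℂ) ^ 3 - t ^ 3)⁻¹ := fun c => by
      have h := congrArg (fun k : C(Circle, ℂ) => k c) (Ring.inverse_mul_cancel _ hunit)
      refine eq_inv_of_mul_eq_one_left ?_
      simpa [τ] using h
    have hJ := circleIntegralCLM_apply r
      (Φ (ψ z + φ₀) * (τ ^ 2 * Ring.inverse (τ ^ 3 - t ^ 3 • 1)))
      (fun s => g (z, s) * (s ^ 2 * (s ^ 3 - t ^ 3)⁻¹)) fun c => by
        rw [ContinuousMap.mul_apply, ContinuousMap.mul_apply, hinv,
          (hball _ (hφnorm z (hz.trans hrR))).2 c, hφ]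
        rfl
    have hd : DifferentiableOn ℂ (fun s => g (z, s)) (Metric.closedBall 0 r) := by
      intro s hs
      have hmem : (z, s) ∈ Metric.ball (0 : E × ℂ) R' := by
        rw [mem_ball_zero_iff, Prod.norm_def, max_lt_iff]
        exact ⟨hz.trans hrR', (mem_closedBall_zero_iff.1 hs).trans_lt hrR'⟩
      exact ((hball' _ hmem).differentiableAt.comp s
        (by fun_prop : DifferentiableAt ℂ (fun s => (z, s)) s)).differentiableWithinAt
    change (2 * Real.pi * Complex.I)⁻¹ * _ = _
    rw [hJ, circleIntegral_cube_sub_inv hω hd ht, inv_mul_cancel_left₀ Complex.two_pi_I_ne_zero]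

/-- The set `{(z, z̄)}` is a uniqueness set for germs of analytic functions of `(z, ζ)`. -/
lemma AnalyticAt.eventually_eq_zero_of_conj {ι : Type*} [Fintype ι]
    {h : (ι → ℂ) × (ι → ℂ) → ℂ} (hh : AnalyticAt ℂ h 0)
    (hz : ∀ᶠ z : ι → ℂ in 𝓝 0, h (z, star z) = 0) : ∀ᶠ p in 𝓝 0, h p = 0 := by
  obtain ⟨R₁, hR₁, hana⟩ := Metric.eventually_nhds_iff_ball.1 hh.eventually_analyticAt
  obtain ⟨R₂, hR₂, hzero⟩ := Metric.eventually_nhds_iff_ball.1 hz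
  set R := min R₁ R₂
  have hR : 0 < R := lt_min hR₁ hR₂
  filter_upwards [Metric.ball_mem_nhds 0 (by positivity : 0 < R / 4)] with p hp
  obtain ⟨z, ζ⟩ := p
  rw [mem_ball_zero_iff, Prod.norm_def, max_lt_iff] at hp
  obtain ⟨hz4 : ‖z‖ < R / 4, hζ4 : ‖ζ‖ < R / 4⟩ := hp
  have hsζ : ‖star ζ‖ < R / 4 := by rwa [norm_star]
  set a : ι → ℂ := (2⁻¹ : ℂ) • (z + star ζ)
  set b : ι → ℂ := (-(Complex.I / 2)) • (z - star ζ)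
  have ha : ‖a‖ < R / 4 := by
    have := norm_add_le z (star ζ)
    rw [norm_smul]
    norm_num
    linarith
  have hb : ‖b‖ < R / 4 := by
    have := norm_sub_le z (star ζ)
    rw [norm_smul]
    norm_num
    linarith
  have hline : ∀ (x y : ι → ℂ) (t : ℂ), ‖x‖ < R / 4 → ‖y‖ < R / 4 → ‖t‖ < 2 →
      ‖x + t • y‖ < R := by
    intro x y t hx hy ht
    have h1 := norm_add_le x (t • y)
    rw [norm_smul] at h1
    nlinarith [norm_nonneg y]
  have hφ : AnalyticOnNhd ℂ (fun t : ℂ => h (a + t • b, star a + t • star b))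
      (Metric.ball 0 2) := by
    intro t ht
    rw [mem_ball_zero_iff] at ht
    refine AnalyticAt.fun_comp (g := h) (hana _ ?_) (by fun_prop)
    rw [mem_ball_zero_iff, Prod.norm_def, max_lt_iff]
    exact ⟨(hline a b t ha hb ht).trans_le (min_le_left _ _),
      (hline _ _ t (by rwa [norm_star]) (by rwa [norm_star]) ht).trans_le (min_le_left _ _)⟩
  have hfreq : ∃ᶠ t : ℂ in 𝓝[≠] 0, h (a + t • b, star a + t • star b) = 0 := by
    have htend : Tendsto (fun x : ℝ => (x : ℂ)) (𝓝[≠] 0) (𝓝[≠] 0) := by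
      refine tendsto_nhdsWithin_of_tendsto_nhds_of_eventually_within _ ?_ ?_
      · exact (Complex.continuous_ofReal.tendsto' 0 0 (by simp)).mono_left nhdsWithin_le_nhds
      · filter_upwards [self_mem_nhdsWithin] with x hx
        simpa using hx
    refine htend.frequently (Eventually.frequently ?_)
    filter_upwards [nhdsWithin_le_nhds (Metric.ball_mem_nhds (0 : ℝ) two_pos)] with x hx
    have hx2 : ‖(x : ℂ)‖ < 2 := by simpa using hx
    have hs : star a + (x : ℂ) • star b = star (a + (x : ℂ) • b) := by simp
    rw [hs]
    exact hzero _ (mem_ball_zero_iff.2 ((hline a b x ha hb hx2).trans_le (min_le_right _ _)))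
  have hI := hφ.eqOn_zero_of_preconnected_of_frequently_eq_zero
    (convex_ball (0 : ℂ) 2).isPreconnected (Metric.mem_ball_self two_pos) hfreq
    (show Complex.I ∈ Metric.ball (0 : ℂ) 2 by simp)
  have e1 : a + Complex.I • b = z := by
    ext i
    simp only [a, b, Pi.add_apply, Pi.smul_apply, Pi.sub_apply, smul_eq_mul]
    linear_combination (-(z i - star ζ i) / 2) * Complex.I_sq
  have e2 : star a + Complex.I • star b = ζ := by
    ext i
    simp [a, b]
    linear_combination ((starRingEnd ℂ (z i) - ζ i) / 2) * Complex.I_sq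
  simpa [e1, e2] using hI

/-- A solution of `3 ζ₂² ∂f/∂ζ₁ - z₂ ∂f/∂ζ₂ = 0` is constant along the curve
`ζ₁ z₂ + ζ₂³ = t³` for fixed `z` with `z₂ ≠ 0`. -/
lemma eq_along_leaf {f : (Fin 2 → ℂ) × (Fin 2 → ℂ) → ℂ} {R δ : ℝ}
    (hf : ∀ p ∈ Metric.ball 0 R, DifferentiableAt ℂ f p)
    (hL : ∀ p ∈ Metric.ball 0 R, 3 * p.2 1 ^ 2 * fderiv ℂ f p (0, Pi.single 0 1) -
      p.1 1 * fderiv ℂ f p (0, Pi.single 1 1) = 0)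
    {z ζ : Fin 2 → ℂ} {t : ℂ} (hz1 : z 1 ≠ 0) (hz : ‖z‖ < R) (hδ : δ ≤ R)
    (hζ : ‖ζ 1‖ < δ) (ht : ‖t‖ < δ) (hw : t ^ 3 = ζ 0 * z 1 + ζ 1 ^ 3)
    (hbound : 2 * δ ^ 3 < R * ‖z 1‖) : f (z, ζ) = f (z, ![0, t]) := by
  let c : ℂ → (Fin 2 → ℂ) × (Fin 2 → ℂ) := fun s => (z, ![(t ^ 3 - s ^ 3) / z 1, s])
  have hc : ∀ s, HasDerivAt c (0, ![-(3 * s ^ 2) / z 1, 1]) s := by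
    intro s
    refine (hasDerivAt_const s z).prodMk (hasDerivAt_pi.2 fun i => ?_)
    fin_cases i
    · simpa using! (((hasDerivAt_pow 3 s).const_sub (t ^ 3)).div_const (z 1))
    · simpa using! hasDerivAt_id s
  have hmem : ∀ s ∈ Metric.ball (0 : ℂ) δ, c s ∈ Metric.ball 0 R := by
    intro s hs
    rw [mem_ball_zero_iff] at hs
    have hR : 0 < R := (norm_nonneg z).trans_lt hz
    rw [mem_ball_zero_iff, Prod.norm_def, max_lt_iff]
    refine ⟨hz, (pi_norm_lt_iff hR).2 fun i => ?_⟩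
    fin_cases i
    · change ‖(t ^ 3 - s ^ 3) / z 1‖ < R
      rw [norm_div, div_lt_iff₀ (norm_pos_iff.2 hz1)]
      have h1 := norm_sub_le (t ^ 3) (s ^ 3)
      rw [norm_pow, norm_pow] at h1
      have h2 := pow_le_pow_left₀ (norm_nonneg t) ht.le 3
      have h3 := pow_le_pow_left₀ (norm_nonneg s) hs.le 3
      linarith
    · exact hs.trans_le hδ
  have hder : ∀ s ∈ Metric.ball (0 : ℂ) δ, HasDerivAt (f ∘ c) 0 s := by
    intro s hs
    have h := (hf _ (hmem s hs)).hasFDerivAt.comp_hasDerivAt s (hc s)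
    refine h.congr_deriv ?_
    have hdir : ((0, ![-(3 * s ^ 2) / z 1, 1]) : (Fin 2 → ℂ) × (Fin 2 → ℂ)) =
        (-(3 * s ^ 2) / z 1) • (0, Pi.single 0 1) + (0, Pi.single 1 1) := by
      ext i <;> fin_cases i <;> simp
    rw [hdir, map_add, map_smul, smul_eq_mul]
    have := hL _ (hmem s hs)
    change 3 * s ^ 2 * _ - z 1 * _ = 0 at this
    field_simp
    linear_combination -this
  have hconst := Metric.isOpen_ball.is_const_of_deriv_eq_zero
    (convex_ball (0 : ℂ) δ).isPreconnected
    (fun s hs => (hder s hs).differentiableAt.differentiableWithinAt)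
    (fun s hs => (hder s hs).deriv)
    (mem_ball_zero_iff.2 hζ) (mem_ball_zero_iff.2 ht)
  have e : ![(t ^ 3 - ζ 1 ^ 3) / z 1, ζ 1] = ζ := by
    ext i
    fin_cases i
    · simp [hw, hz1]
    · simp
  simpa [c, e] using hconst

/-- An analytic solution near `0` of `3 ζ₂² ∂f/∂ζ₁ - z₂ ∂f/∂ζ₂ = 0` is an analytic function of
`z` and `ζ₁ z₂ + ζ₂³`. -/
lemma exists_analyticAt_factorization {f : (Fin 2 → ℂ) × (Fin 2 → ℂ) → ℂ}
    (hf : AnalyticAt ℂ f 0)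
    (hL : ∀ᶠ p in 𝓝 0, 3 * p.2 1 ^ 2 * fderiv ℂ f p (0, Pi.single 0 1) -
      p.1 1 * fderiv ℂ f p (0, Pi.single 1 1) = 0) :
    ∃ F : (Fin 2 → ℂ) × ℂ → ℂ, AnalyticAt ℂ F 0 ∧
      ∀ᶠ p in 𝓝 0, f p = F (p.1, p.2 0 * p.1 1 + p.2 1 ^ 3) := by
  obtain ⟨y, hy⟩ := IsAlgClosed.exists_pow_nat_eq (-3 : ℂ) two_pos
  obtain ⟨ω, hω⟩ : ∃ ω : ℂ, ω ^ 2 + ω + 1 = 0 :=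
    ⟨(-1 + y) / 2, by linear_combination hy / 4⟩
  have hω3 : ω ^ 3 = 1 := by linear_combination (ω - 1) * hω
  have hωn : ‖ω‖ = 1 := Complex.norm_eq_one_of_pow_eq_one hω3 (by norm_num)
  let j : (Fin 2 → ℂ) × ℂ →L[ℂ] (Fin 2 → ℂ) × (Fin 2 → ℂ) :=
    (ContinuousLinearMap.id ℂ _).prodMap (ContinuousLinearMap.single ℂ (fun _ : Fin 2 => ℂ) 1)
  have hj : ∀ z t, j (z, t) = (z, ![0, t]) := by
    intro z t
    ext i <;> fin_cases i <;> simp [j]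
  have hg : AnalyticAt ℂ (f ∘ j) 0 :=
    AnalyticAt.comp (by simpa using hf) (j.analyticAt 0)
  obtain ⟨F, hF, hFval⟩ := hg.exists_cubeRoot_average hω
  refine ⟨F, hF, ?_⟩
  let ρ : (Fin 2 → ℂ) × (Fin 2 → ℂ) → ℂ := fun p => p.2 0 * p.1 1 + p.2 1 ^ 3
  have hρ : Continuous ρ := by fun_prop
  have hGF : AnalyticAt ℂ (fun p => F (p.1, ρ p)) 0 := by
    let L₀ : (Fin 2 → ℂ) × (Fin 2 → ℂ) →L[ℂ] ℂ :=
      (ContinuousLinearMap.proj 0).comp (ContinuousLinearMap.snd ℂ _ _)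
    let L₁ : (Fin 2 → ℂ) × (Fin 2 → ℂ) →L[ℂ] ℂ :=
      (ContinuousLinearMap.proj 1).comp (ContinuousLinearMap.fst ℂ _ _)
    let L₂ : (Fin 2 → ℂ) × (Fin 2 → ℂ) →L[ℂ] ℂ :=
      (ContinuousLinearMap.proj 1).comp (ContinuousLinearMap.snd ℂ _ _)
    have h0 : ((0 : (Fin 2 → ℂ) × (Fin 2 → ℂ)).1, ρ 0) = 0 := by simp [ρ]
    exact AnalyticAt.fun_comp (g := F) (h0 ▸ hF)
      (analyticAt_fst.prod (((L₀.analyticAt 0).mul (L₁.analyticAt 0)).add ((L₂.analyticAt 0).pow 3)))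
  obtain ⟨R₁, hR₁, hball₁⟩ := Metric.eventually_nhds_iff_ball.1
    ((hf.eventually_analyticAt.and hGF.eventually_analyticAt).and hL)
  obtain ⟨R₂, hR₂, hball₂⟩ := Metric.eventually_nhds_iff_ball.1 hFval
  set R := min R₁ R₂
  have hR : 0 < R := lt_min hR₁ hR₂
  have hsub : Metric.ball (0 : (Fin 2 → ℂ) × (Fin 2 → ℂ)) R ⊆ Metric.ball 0 R₁ :=
    Metric.ball_subset_ball (min_le_left _ _)
  obtain ⟨δ, hδ, hδR, hδ3⟩ : ∃ δ : ℝ, 0 < δ ∧ δ < R ∧ 2 * δ ^ 3 < R * (R / 4) := by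
    have h1 : ∀ᶠ δ : ℝ in 𝓝[>] 0, δ < R := nhdsWithin_le_nhds (eventually_lt_nhds hR)
    have h2 : ∀ᶠ δ : ℝ in 𝓝[>] 0, 2 * δ ^ 3 < R * (R / 4) := by
      have : Continuous fun δ : ℝ => 2 * δ ^ 3 := by fun_prop
      exact nhdsWithin_le_nhds ((this.tendsto 0).eventually_lt_const (by simp; positivity))
    exact ((eventually_mem_nhdsWithin.and (h1.and h2)).exists)
  let p₀ : (Fin 2 → ℂ) × (Fin 2 → ℂ) := (Pi.single 1 ((R / 2 : ℝ) : ℂ), 0)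
  have hp₀ : p₀ ∈ Metric.ball 0 R := by
    rw [mem_ball_zero_iff, Prod.norm_def, Pi.norm_single, Complex.norm_real, Real.norm_eq_abs,
      abs_of_pos (half_pos hR)]
    simpa [p₀] using hR
  have hloc : f =ᶠ[𝓝 p₀] fun p => F (p.1, ρ p) := by
    have hw : ∀ᶠ p in 𝓝 p₀, ‖ρ p‖ < δ ^ 3 :=
      (hρ.norm.tendsto p₀).eventually_lt_const (by simp [ρ, p₀]; positivity)
    have hζ : ∀ᶠ p in 𝓝 p₀, ‖p.2 1‖ < δ := by
      have : Continuous fun p : (Fin 2 → ℂ) × (Fin 2 → ℂ) => ‖p.2 1‖ := by fun_prop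
      exact (this.tendsto p₀).eventually_lt_const (by simpa [p₀] using hδ)
    have hz1 : ∀ᶠ p in 𝓝 p₀, R / 4 < ‖p.1 1‖ := by
      have : Continuous fun p : (Fin 2 → ℂ) × (Fin 2 → ℂ) => ‖p.1 1‖ := by fun_prop
      refine (this.tendsto p₀).eventually_const_lt ?_
      simp only [p₀, Pi.single_eq_same, Complex.norm_real, Real.norm_eq_abs,
        abs_of_pos (half_pos hR)]
      linarith
    filter_upwards [hw, hζ, hz1, Metric.isOpen_ball.mem_nhds hp₀] with p hw hζ hz1 hpR
    have hzR : ‖p.1‖ < R := (norm_fst_le p).trans_lt (mem_ball_zero_iff.1 hpR)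
    obtain ⟨t, ht⟩ := IsAlgClosed.exists_pow_nat_eq (ρ p) three_pos
    have htδ : ‖t‖ < δ := by
      rw [← ht, norm_pow] at hw
      exact lt_of_pow_lt_pow_left₀ 3 hδ.le hw
    have hleaf : ∀ a : ℂ, a ^ 3 = 1 → ‖a‖ = 1 → f p = f (p.1, ![0, a * t]) := by
      intro a ha ha1
      refine eq_along_leaf (R := R) (δ := δ) (fun q hq => (hball₁ q (hsub hq)).1.1.differentiableAt)
        (fun q hq => (hball₁ q (hsub hq)).2) (norm_pos_iff.1 (by linarith)) hzR hδR.le hζ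
        (by simpa [ha1] using htδ) (by rw [mul_pow, ha, one_mul, ht]) ?_
      nlinarith
    have havg := hball₂ (p.1, t) (by
      rw [mem_ball_zero_iff, Prod.norm_def, max_lt_iff]
      exact ⟨hzR.trans_le (min_le_right _ _), (htδ.trans hδR).trans_le (min_le_right _ _)⟩)
    have h1 := hleaf 1 (by simp) (by simp)
    have h2 := hleaf ω hω3 hωn
    have h3 := hleaf (ω ^ 2) (by rw [← pow_mul, mul_comm, pow_mul, hω3, one_pow]) (by simp [hωn])
    simp only [Function.comp_apply, hj, ht] at havg
    rw [one_mul] at h1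
    rw [havg, ← h1, ← h2, ← h3]
    ring
  have heq := AnalyticOnNhd.eqOn_of_preconnected_of_eventuallyEq
    (fun q hq => (hball₁ q (hsub hq)).1.1) (fun q hq => (hball₁ q (hsub hq)).1.2)
    (convex_ball _ R).isPreconnected hp₀ hloc
  filter_upwards [Metric.ball_mem_nhds 0 hR] with p hp using heq hp

/-- **Example 3.3:** on `M = {w = z̄₁z₂ + z̄₂³} ⊂ ℂ³` every real-analytic CR
function extends holomorphically.  A real-analytic `f(z,z̄)` is encoded by its
holomorphic complexification `f : ℂ² × ℂ² → ℂ` evaluated at `(z, z̄)`, and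
`ρ(z,ζ) = ζ₁z₂ + ζ₂³` is the complexification of `ρ(z,z̄) = z̄₁z₂ + z̄₂³`.
The CR condition is `ρ_{z̄₂} ∂f/∂z̄₁ − ρ_{z̄₁} ∂f/∂z̄₂ = 0` near `0`. -/
theorem stmt_17 (f : (Fin 2 → ℂ) × (Fin 2 → ℂ) → ℂ)
    (hf : AnalyticAt ℂ f 0)
    (hCR : ∀ᶠ z : Fin 2 → ℂ in 𝓝 0,
      fderiv ℂ (fun p : (Fin 2 → ℂ) × (Fin 2 → ℂ) => p.2 0 * p.1 1 + (p.2 1) ^ 3)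
          (z, star z) (0, Pi.single 1 1) *
        fderiv ℂ f (z, star z) (0, Pi.single 0 1) -
      fderiv ℂ (fun p : (Fin 2 → ℂ) × (Fin 2 → ℂ) => p.2 0 * p.1 1 + (p.2 1) ^ 3)
          (z, star z) (0, Pi.single 0 1) *
        fderiv ℂ f (z, star z) (0, Pi.single 1 1) = 0) :
    ∃ F : (Fin 2 → ℂ) × ℂ → ℂ, AnalyticAt ℂ F 0 ∧
      ∀ᶠ z : Fin 2 → ℂ in 𝓝 0,
        f (z, star z) = F (z, star (z 0) * z 1 + (star (z 1)) ^ 3) := by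
  let L₀ : (Fin 2 → ℂ) × (Fin 2 → ℂ) →L[ℂ] ℂ :=
    (ContinuousLinearMap.proj 0).comp (ContinuousLinearMap.snd ℂ _ _)
  let L₁ : (Fin 2 → ℂ) × (Fin 2 → ℂ) →L[ℂ] ℂ :=
    (ContinuousLinearMap.proj 1).comp (ContinuousLinearMap.fst ℂ _ _)
  let L₂ : (Fin 2 → ℂ) × (Fin 2 → ℂ) →L[ℂ] ℂ :=
    (ContinuousLinearMap.proj 1).comp (ContinuousLinearMap.snd ℂ _ _)
  have hρ : ∀ p v : (Fin 2 → ℂ) × (Fin 2 → ℂ),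
      fderiv ℂ (fun p : (Fin 2 → ℂ) × (Fin 2 → ℂ) => p.2 0 * p.1 1 + (p.2 1) ^ 3) p v =
        p.2 0 * v.1 1 + p.1 1 * v.2 0 + 3 * p.2 1 ^ 2 * v.2 1 := by
    intro p v
    have h : HasFDerivAt (fun p : (Fin 2 → ℂ) × (Fin 2 → ℂ) => p.2 0 * p.1 1 + (p.2 1) ^ 3) _ p :=
      ((L₀.hasFDerivAt (x := p)).mul L₁.hasFDerivAt).add (L₂.hasFDerivAt.pow 3)
    rw [h.fderiv]
    simp [L₀, L₁, L₂]
  have hL : ∀ᶠ p in 𝓝 0, 3 * p.2 1 ^ 2 * fderiv ℂ f p (0, Pi.single 0 1) -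
      p.1 1 * fderiv ℂ f p (0, Pi.single 1 1) = 0 := by
    refine AnalyticAt.eventually_eq_zero_of_conj ?_ ?_
    · have hd := hf.fderiv
      have hd' : ∀ v, AnalyticAt ℂ (fun p => fderiv ℂ f p v) 0 := fun v =>
        ((ContinuousLinearMap.apply ℂ ℂ v).analyticAt _).comp hd
      exact ((analyticAt_const.mul ((L₂.analyticAt 0).pow 2)).mul (hd' _)).sub
        ((L₁.analyticAt 0).mul (hd' _))
    · filter_upwards [hCR] with z hz
      simpa [hρ] using hz
  obtain ⟨F, hF, hfF⟩ := exists_analyticAt_factorization hf hL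
  refine ⟨F, hF, ?_⟩
  have hcont : Tendsto (fun z : Fin 2 → ℂ => (z, star z)) (𝓝 0) (𝓝 0) :=
    Continuous.tendsto' (by fun_prop) _ _ (by simp)
  exact hcont.eventually hfF
end

section
/- Let n ≥ 2 and let M ⊂ ℂ^{n+1} be given near the origin by w = ρ(z,z̄) = z*Az + conj(zᵀBz) + zᵀCz + E(z,z̄), where ρ is real-analytic, A, B, C are complex n×n matrices with B and C symmetric, and E(z,z̄) = O(|z|³). Assume the (2n)×n matrix obtained by stacking A* on top of B has rank at least 2. Then the following are equivalent: (a) M is flattenable, i.e., there exists a nonconstant holomorphic function h on a neighborhood of 0 in ℂ^{n+1} with nonvanishing derivative on M that is real-valued on M; (b) there exists a nonconstant real-valued real-analytic function g(z,z̄) defined near 0 ∈ ℂⁿ with ρ_{z̄_ℓ} ∂g/∂z̄_k − ρ_{z̄_k} ∂g/∂z̄_ℓ = 0 for all 1 ≤ k,ℓ ≤ n (so g is a first integral of the complex tangent bundle of M), whose second-order Taylor coefficients at the origin (in z and z̄) are not all zero. -/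
open Matrix Filter Asymptotics Topology

section Osgood

variable {E F : Type} [NormedAddCommGroup E] [NormedSpace ℂ E]
  [NormedAddCommGroup F] [NormedSpace ℂ F]

theorem norm_fderiv_le_of_forall_mem_ball_norm_le {f : E → F} {c : E} {r M : ℝ}
    (hr : 0 < r) (hf : DifferentiableOn ℂ f (Metric.ball c r))
    (hM : ∀ x ∈ Metric.ball c r, ‖f x‖ ≤ M) : ‖fderiv ℂ f c‖ ≤ 2 * M / r := by
  refine Complex.norm_fderiv_le_div_of_mapsTo_ball hf (fun x hx => ?_) hr
  rw [mem_closedBall_iff_norm]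
  have h1 := hM x hx
  have h2 := hM c (Metric.mem_ball_self hr)
  linarith [norm_sub_le (f x) (f c)]

theorem exists_ball_bound_of_differentiableOn {f : E × ℂ → F} {W : Set (E × ℂ)} (hW : IsOpen W)
    (hf : DifferentiableOn ℂ f W) {K : Set ℂ} (hK : IsCompact K) {x₀ : E}
    (h : ∀ t ∈ K, (x₀, t) ∈ W) :
    ∃ r > 0, ∃ M > 0, ∀ x ∈ Metric.ball x₀ r, ∀ t ∈ K, (x, t) ∈ W ∧ ‖f (x, t)‖ < M := by
  have hK' : IsCompact ({x₀} ×ˢ K) := isCompact_singleton.prod hK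
  have hKW : {x₀} ×ˢ K ⊆ W := by
    rintro ⟨x, t⟩ ⟨hx, ht⟩
    obtain rfl : x = x₀ := hx
    exact h t ht
  obtain ⟨M, hM⟩ := hK'.exists_bound_of_continuousOn (hf.continuousOn.mono hKW)
  have hO : IsOpen (W ∩ f ⁻¹' Metric.ball 0 (max M 0 + 1)) :=
    hf.continuousOn.isOpen_inter_preimage hW Metric.isOpen_ball
  obtain ⟨r, hr, hrO⟩ := hK'.exists_thickening_subset_open hO (fun q hq => ⟨hKW hq, by
    have := hM q hq
    simp only [Set.mem_preimage, mem_ball_zero_iff]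
    exact (this.trans (le_max_left _ _)).trans_lt (lt_add_one _)⟩)
  refine ⟨r, hr, max M 0 + 1, by positivity, fun x hx t ht => ?_⟩
  have : (x, t) ∈ Metric.thickening r ({x₀} ×ˢ K) := by
    rw [Metric.mem_thickening_iff]
    refine ⟨(x₀, t), ⟨rfl, ht⟩, ?_⟩
    rw [Prod.dist_eq]
    simpa using hx
  have := hrO this
  exact ⟨this.1, by simpa using this.2⟩

variable [FiniteDimensional ℂ E]

theorem differentiableAt_of_forall_clm_apply {D : Type} [NormedAddCommGroup D] [NormedSpace ℂ D]
    {f : D → E →L[ℂ] F} {x : D} (h : ∀ y, DifferentiableAt ℂ (fun x => f x y) x) :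
    DifferentiableAt ℂ f x := by
  let d := Module.finrank ℂ E
  have hd : d = Module.finrank ℂ (Fin d → ℂ) := (Module.finrank_fin_fun ℂ).symm
  let e₁ := ContinuousLinearEquiv.ofFinrankEq hd
  let e₂ := (e₁.arrowCongr (1 : F ≃L[ℂ] F)).trans (ContinuousLinearEquiv.piRing (Fin d))
  rw [← Function.id_comp f, ← e₂.symm_comp_self]
  exact e₂.symm.differentiableAt.comp x (differentiableAt_pi.2 fun i => h _)

variable [FiniteDimensional ℂ F]

theorem differentiableAt_circleIntegral {f : E × ℂ → F} {W : Set (E × ℂ)} (hW : IsOpen W)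
    (hf : DifferentiableOn ℂ f W) {x₀ : E} {R : ℝ} (hR : 0 ≤ R)
    (h : ∀ t ∈ Metric.sphere (0 : ℂ) R, (x₀, t) ∈ W) :
    DifferentiableAt ℂ (fun x => ∮ t in C(0, R), f (x, t)) x₀ := by
  obtain ⟨r, hr, M, hM, hrM⟩ :=
    exists_ball_bound_of_differentiableOn hW hf (isCompact_sphere (0 : ℂ) R) h
  borelize E
  borelize F
  have hmem (θ : ℝ) : circleMap 0 R θ ∈ Metric.sphere (0 : ℂ) R := circleMap_mem_sphere 0 hR θ
  have hcont (x : E) (hx : x ∈ Metric.ball x₀ r) :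
      Continuous fun θ : ℝ => deriv (circleMap 0 R) θ • f (x, circleMap 0 R θ) := by
    have h1 : Continuous fun θ : ℝ => deriv (circleMap 0 R) θ := by
      simp only [deriv_circleMap]; fun_prop
    refine h1.smul (continuous_iff_continuousAt.2 fun θ => ?_)
    have h2 : ContinuousAt f (x, circleMap 0 R θ) :=
      hf.continuousOn.continuousAt (hW.mem_nhds (hrM x hx _ (hmem θ)).1)
    exact ContinuousAt.comp (f := fun θ : ℝ => (x, circleMap 0 R θ)) h2 (by fun_prop)
  have hx₀ : x₀ ∈ Metric.ball x₀ r := Metric.mem_ball_self hr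
  have hdiff (x : E) (hx : x ∈ Metric.ball x₀ r) (θ : ℝ) :
      HasFDerivAt (fun x => f (x, circleMap 0 R θ))
        ((fderiv ℂ f (x, circleMap 0 R θ)).comp (ContinuousLinearMap.inl ℂ E ℂ)) x := by
    have h2 : HasFDerivAt f (fderiv ℂ f (x, circleMap 0 R θ)) (x, circleMap 0 R θ) :=
      (hf.differentiableAt (hW.mem_nhds (hrM x hx _ (hmem θ)).1)).hasFDerivAt
    exact h2.comp x (hasFDerivAt_prodMk_left x _)
  have key := intervalIntegral.hasFDerivAt_integral_of_dominated_of_fderiv_le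
    (μ := MeasureTheory.volume) (a := 0) (b := 2 * Real.pi) (x₀ := x₀) (𝕜 := ℂ)
    (F := fun x θ => deriv (circleMap 0 R) θ • f (x, circleMap 0 R θ))
    (F' := fun x θ => deriv (circleMap 0 R) θ •
      ((fderiv ℂ f (x, circleMap 0 R θ)).comp (ContinuousLinearMap.inl ℂ E ℂ)))
    (bound := fun _ => R * (2 * M / (r / 2))) (s := Metric.ball x₀ (r / 2))
    (Metric.ball_mem_nhds _ (by positivity)) ?_ ?_ ?_ ?_ ?_ ?_
  · exact key.differentiableAt
  · filter_upwards [Metric.ball_mem_nhds x₀ hr] with x hx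
    exact (hcont x hx).aestronglyMeasurable
  · exact (hcont x₀ hx₀).intervalIntegrable _ _
  · have h1 : Continuous fun θ : ℝ => deriv (circleMap 0 R) θ := by
      simp only [deriv_circleMap]; fun_prop
    refine (h1.aestronglyMeasurable).smul ?_
    have h2 : Measurable fun θ : ℝ => fderiv ℂ f (x₀, circleMap 0 R θ) :=
      (measurable_fderiv ℂ f).comp
        ((continuous_const.prodMk (continuous_circleMap 0 R)).measurable)
    have h3 : Continuous fun l : (E × ℂ) →L[ℂ] F => l.comp (ContinuousLinearMap.inl ℂ E ℂ) := by
      fun_prop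
    exact (h3.comp_stronglyMeasurable h2.stronglyMeasurable).aestronglyMeasurable
  · refine Eventually.of_forall fun θ _ x hx => ?_
    have hb : Metric.ball x (r / 2) ⊆ Metric.ball x₀ r := by
      refine Metric.ball_subset_ball' ?_
      have := Metric.mem_ball.1 hx
      linarith
    have hx' : x ∈ Metric.ball x₀ r := Metric.ball_subset_ball (by linarith) hx
    have h1 := norm_fderiv_le_of_forall_mem_ball_norm_le (f := fun x => f (x, circleMap 0 R θ))
      (c := x) (r := r / 2) (M := M) (by positivity)
      (fun y hy => (hdiff y (hb hy) θ).differentiableAt.differentiableWithinAt)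
      (fun y hy => (hrM y (hb hy) _ (hmem θ)).2.le)
    rw [(hdiff x hx' θ).fderiv] at h1
    rw [norm_smul]
    refine mul_le_mul ?_ h1 (norm_nonneg _) hR
    simp [deriv_circleMap, abs_of_nonneg hR]
  · exact continuous_const.intervalIntegrable _ _
  · exact Eventually.of_forall fun θ _ x hx =>
      (hdiff x (Metric.ball_subset_ball (by linarith) hx) θ).const_smul _

theorem differentiableAt_fderiv_of_eventually {f : E → F} {x₀ : E}
    (hf : ∀ᶠ x in 𝓝 x₀, DifferentiableAt ℂ f x) : DifferentiableAt ℂ (fderiv ℂ f) x₀ := by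
  refine differentiableAt_of_forall_clm_apply fun v => ?_
  obtain ⟨r, hr, hfr⟩ := Metric.eventually_nhds_iff_ball.1 hf
  obtain ⟨R, hR, hRv⟩ : ∃ R > 0, R * ‖v‖ < r / 2 := by
    refine ⟨r / (4 * (‖v‖ + 1)), by positivity, ?_⟩
    rw [div_mul_eq_mul_div, div_lt_div_iff₀ (by positivity) (by positivity)]
    nlinarith [norm_nonneg v]
  have hmem {x : E} (hx : x ∈ Metric.ball x₀ (r / 2)) {t : ℂ}
      (ht : t ∈ Metric.closedBall (0 : ℂ) R) : x + t • v ∈ Metric.ball x₀ r := by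
    rw [mem_ball_iff_norm] at hx ⊢
    rw [mem_closedBall_zero_iff] at ht
    calc ‖x + t • v - x₀‖ = ‖(x - x₀) + t • v‖ := by congr 1; abel
      _ ≤ ‖x - x₀‖ + ‖t‖ * ‖v‖ := by rw [← norm_smul]; exact norm_add_le _ _
      _ ≤ ‖x - x₀‖ + R * ‖v‖ := by gcongr
      _ < r := by linarith
  have hlin (x : E) : Continuous fun t : ℂ => x + t • v := by fun_prop
  have heq : ∀ x ∈ Metric.ball x₀ (r / 2), fderiv ℂ f x v =
      (2 * Real.pi * Complex.I : ℂ)⁻¹ • ∮ t in C(0, R), (1 / t ^ 2) • f (x + t • v) := by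
    intro x hx
    have hd : DifferentiableOn ℂ (fun t : ℂ => f (x + t • v)) (Metric.closedBall 0 R) :=
      fun t ht => ((hfr _ (hmem hx ht)).comp t (by fun_prop)).differentiableWithinAt
    have h1 := hd.deriv_eq_smul_circleIntegral hR
    have h2 : deriv (fun t : ℂ => f (x + t • v)) 0 = fderiv ℂ f x v := by
      have h3 : HasFDerivAt f (fderiv ℂ f x) (x + (0 : ℂ) • v) := by
        have := hfr x (Metric.ball_subset_ball (by linarith) hx)
        simpa using this.hasFDerivAt
      have h4 : HasDerivAt (fun t : ℂ => x + t • v) v 0 := by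
        simpa using ((hasDerivAt_id (0 : ℂ)).smul_const v).const_add x
      exact (h3.comp_hasDerivAt (0 : ℂ) h4).deriv
    simp only [sub_zero] at h1
    rw [h1, h2, inv_smul_smul₀ Complex.two_pi_I_ne_zero]
  have hW : IsOpen {q : E × ℂ | q.1 + q.2 • v ∈ Metric.ball x₀ r ∧ q.2 ≠ 0} := by
    refine IsOpen.inter (Metric.isOpen_ball.preimage (by fun_prop)) ?_
    exact isOpen_compl_singleton.preimage continuous_snd
  have hd : DifferentiableOn ℂ (fun q : E × ℂ => (1 / q.2 ^ 2) • f (q.1 + q.2 • v))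
      {q : E × ℂ | q.1 + q.2 • v ∈ Metric.ball x₀ r ∧ q.2 ≠ 0} := by
    rintro q ⟨h1, h2⟩
    refine DifferentiableAt.differentiableWithinAt ?_
    refine DifferentiableAt.smul ?_ ?_
    · have : q.2 ^ 2 ≠ 0 := pow_ne_zero _ h2
      fun_prop (disch := assumption)
    · exact (hfr _ h1).comp (f := fun q : E × ℂ => q.1 + q.2 • v) q (by fun_prop)
  have h5 := (differentiableAt_circleIntegral hW hd hR.le (x₀ := x₀) (fun t ht =>
    ⟨hmem (Metric.mem_ball_self (by positivity)) (Metric.sphere_subset_closedBall ht), by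
      rintro rfl; simp at ht; exact hR.ne ht⟩)).const_smul (2 * Real.pi * Complex.I : ℂ)⁻¹
  refine h5.congr_of_eventuallyEq ?_
  filter_upwards [Metric.ball_mem_nhds x₀ (half_pos hr)] with x hx using heq x hx

theorem norm_iteratedFDeriv_le_of_forall_mem_ball_norm_le (k : ℕ) :
    ∀ {F : Type} [NormedAddCommGroup F] [NormedSpace ℂ F] [FiniteDimensional ℂ F] {f : E → F}
      {c : E} {r M δ : ℝ}, 0 < δ → k * δ < r → DifferentiableOn ℂ f (Metric.ball c r) →
      (∀ x ∈ Metric.ball c r, ‖f x‖ ≤ M) → ‖iteratedFDeriv ℂ k f c‖ ≤ M * (2 / δ) ^ k := by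
  induction k with
  | zero =>
    intro F _ _ _ f c r M δ hδ hk hf hM
    simp only [Nat.cast_zero, zero_mul] at hk
    simpa using hM c (Metric.mem_ball_self hk)
  | succ k ih =>
    intro F _ _ _ f c r M δ hδ hk hf hM
    push_cast at hk
    rw [← norm_iteratedFDeriv_fderiv]
    have hsub : Metric.ball c (r - δ) ⊆ Metric.ball c r := Metric.ball_subset_ball (by linarith)
    have h := ih (f := fderiv ℂ f) (c := c) (r := r - δ) (M := 2 * M / δ) hδ (by linarith)
      (fun x hx => (differentiableAt_fderiv_of_eventually (by
        filter_upwards [Metric.isOpen_ball.mem_nhds (hsub hx)] with y hy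
        exact hf.differentiableAt (Metric.isOpen_ball.mem_nhds hy))).differentiableWithinAt)
      (fun x hx => by
        have hb : Metric.ball x δ ⊆ Metric.ball c r :=
          Metric.ball_subset_ball' (by linarith [Metric.mem_ball.1 hx])
        exact norm_fderiv_le_of_forall_mem_ball_norm_le hδ (hf.mono hb) fun y hy => hM y (hb hy))
    refine h.trans_eq ?_
    rw [pow_succ]
    ring

theorem differentiableOn_iteratedFDeriv_of_isOpen {U : Set E} (hU : IsOpen U) (k : ℕ) :
    ∀ {F : Type} [NormedAddCommGroup F] [NormedSpace ℂ F] [FiniteDimensional ℂ F] {f : E → F},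
      DifferentiableOn ℂ f U → DifferentiableOn ℂ (iteratedFDeriv ℂ k f) U := by
  induction k with
  | zero =>
    intro F _ _ _ f hf
    rw [iteratedFDeriv_zero_eq_comp]
    exact (LinearIsometryEquiv.differentiable _).comp_differentiableOn hf
  | succ k ih =>
    intro F _ _ _ f hf
    have heq : iteratedFDeriv ℂ (k + 1) f = (continuousMultilinearCurryRightEquiv' ℂ k E F).symm ∘
        iteratedFDeriv ℂ k (fderiv ℂ f) := funext fun x => iteratedFDeriv_succ_eq_comp_right
    rw [heq]
    have hd : DifferentiableOn ℂ (fderiv ℂ f) U := fun x hx => ?_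
    · exact ((continuousMultilinearCurryRightEquiv' ℂ k E F).symm.comp_differentiableOn_iff).2 (ih hd)
    refine (differentiableAt_fderiv_of_eventually ?_).differentiableWithinAt
    filter_upwards [hU.mem_nhds hx] with y hy using hf.differentiableAt (hU.mem_nhds hy)

theorem iteratedDeriv_comp_add_smul {U : Set E} (hU : IsOpen U) {f : E → F}
    (hf : DifferentiableOn ℂ f U) (x y : E) (k : ℕ) :
    ∀ t : ℂ, x + t • y ∈ U → iteratedDeriv k (fun t : ℂ => f (x + t • y)) t =
      iteratedFDeriv ℂ k f (x + t • y) fun _ => y := by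
  induction k with
  | zero => intro t _; simp
  | succ k ih =>
    intro t ht
    have hc : Continuous fun t : ℂ => x + t • y := by fun_prop
    have heq : iteratedDeriv k (fun t : ℂ => f (x + t • y)) =ᶠ[𝓝 t]
        fun t => iteratedFDeriv ℂ k f (x + t • y) fun _ => y := by
      filter_upwards [(hU.preimage hc).mem_nhds ht] with s hs using ih s hs
    rw [iteratedDeriv_succ, heq.deriv_eq, iteratedFDeriv_succ_apply_left]
    have h1 := ((differentiableOn_iteratedFDeriv_of_isOpen hU k hf).differentiableAt
      (hU.mem_nhds ht)).hasFDerivAt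
    have h2 : HasDerivAt (fun t : ℂ => x + t • y) y t := by
      simpa using ((hasDerivAt_id t).smul_const y).const_add x
    have h3 := h1.comp_hasDerivAt t h2
    exact ((ContinuousMultilinearMap.apply ℂ (fun _ : Fin k => E) F
      (fun _ => y)).hasFDerivAt.comp_hasDerivAt t h3).deriv

/-- A function of several complex variables that is complex differentiable near a point is
analytic at that point. -/
theorem analyticAt_of_eventually_differentiableAt {f : E → F} {x₀ : E}
    (hf : ∀ᶠ x in 𝓝 x₀, DifferentiableAt ℂ f x) : AnalyticAt ℂ f x₀ := by
  have hc : ∀ᶠ x in 𝓝 x₀, ‖f x‖ < ‖f x₀‖ + 1 :=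
    (hf.self_of_nhds.continuousAt.norm).eventually (gt_mem_nhds (lt_add_one _))
  obtain ⟨r, hr, hfr⟩ := Metric.eventually_nhds_iff_ball.1 (hf.and hc)
  have hd : DifferentiableOn ℂ f (Metric.ball x₀ r) :=
    fun x hx => (hfr x hx).1.differentiableWithinAt
  set M := ‖f x₀‖ + 1
  have hM : 0 ≤ M := by positivity
  set L : ℝ := 4 * Real.exp 1 / r with hL
  have hLpos : 0 < L := by positivity
  let p : FormalMultilinearSeries ℂ E F := fun k => (k.factorial : ℂ)⁻¹ • iteratedFDeriv ℂ k f x₀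
  have hbound (k : ℕ) : ‖p k‖ ≤ M * L ^ k := by
    have h1 : ‖iteratedFDeriv ℂ k f x₀‖ ≤ M * (4 * k / r) ^ k := by
      rcases Nat.eq_zero_or_pos k with rfl | hk
      · simpa using (hfr x₀ (Metric.mem_ball_self hr)).2.le
      · have hk' : (0 : ℝ) < k := by exact_mod_cast hk
        have := norm_iteratedFDeriv_le_of_forall_mem_ball_norm_le k (δ := r / (2 * k))
          (by positivity) (by field_simp; norm_num) hd fun x hx => (hfr x hx).2.le
        refine this.trans_eq ?_
        congr 2
        field_simp
        norm_num
    have h2 : (k : ℝ) ^ k / k.factorial ≤ Real.exp 1 ^ k := by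
      rw [← Real.exp_nat_mul, mul_one]
      exact Real.pow_div_factorial_le_exp _ k.cast_nonneg k
    calc ‖p k‖ = (k.factorial : ℝ)⁻¹ * ‖iteratedFDeriv ℂ k f x₀‖ := by
          simp [p, norm_smul]
      _ ≤ (k.factorial : ℝ)⁻¹ * (M * (4 * k / r) ^ k) := by gcongr
      _ = M * (4 / r) ^ k * ((k : ℝ) ^ k / k.factorial) := by
          rw [mul_div_right_comm, mul_pow]; ring
      _ ≤ M * (4 / r) ^ k * Real.exp 1 ^ k := by gcongr
      _ = M * L ^ k := by rw [mul_assoc, ← mul_pow, hL]; congr 2; ring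
  have hrad : ENNReal.ofReal (min L⁻¹ (r / 2)) ≤ p.radius := by
    refine p.le_radius_of_bound M fun k => ?_
    have hmin : 0 ≤ min L⁻¹ (r / 2) := by positivity
    rw [Real.coe_toNNReal _ hmin]
    calc ‖p k‖ * min L⁻¹ (r / 2) ^ k ≤ M * L ^ k * L⁻¹ ^ k := by
          gcongr
          · exact hbound k
          · exact min_le_left _ _
      _ = M := by rw [mul_assoc, ← mul_pow, mul_inv_cancel₀ hLpos.ne', one_pow, mul_one]
  refine ⟨p, ENNReal.ofReal (min L⁻¹ (r / 2)), hrad, by simp [hLpos, hr], fun {y} hy => ?_⟩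
  rw [Metric.eball_ofReal, mem_ball_zero_iff] at hy
  have hy' : ‖y‖ < r / 2 := hy.trans_le (min_le_right _ _)
  have hline : ∀ t ∈ Metric.ball (0 : ℂ) 2, x₀ + t • y ∈ Metric.ball x₀ r := by
    intro t ht
    rw [mem_ball_zero_iff] at ht
    rw [mem_ball_iff_norm, add_sub_cancel_left, norm_smul]
    nlinarith [norm_nonneg y, norm_nonneg t]
  have h1 : DifferentiableOn ℂ (fun t : ℂ => f (x₀ + t • y)) (Metric.ball 0 2) :=
    fun t ht => ((hfr _ (hline t ht)).1.comp t (by fun_prop)).differentiableWithinAt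
  have h2 := Complex.hasSum_taylorSeries_on_ball h1 (z := 1) (by simp)
  simp only [one_smul, sub_zero, one_pow] at h2
  convert h2 using 2 with k
  rw [iteratedDeriv_comp_add_smul Metric.isOpen_ball hd x₀ y k 0 (hline 0 (by simp))]
  simp [p]

end Osgood

section Division

variable {E : Type} [NormedAddCommGroup E] [NormedSpace ℂ E]

theorem exists_differentiableOn_eq_mul_of_injOn {φ ψ : ℂ → ℂ} {U : Set ℂ} (hU : IsOpen U)
    (hφ : DifferentiableOn ℂ φ U) (hψ : DifferentiableOn ℂ ψ U) (hinj : Set.InjOn ψ U)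
    (hψ' : ∀ t ∈ U, deriv ψ t ≠ 0) (h0 : ∀ t ∈ U, ψ t = 0 → φ t = 0) :
    ∃ μ : ℂ → ℂ, DifferentiableOn ℂ μ U ∧ ∀ t ∈ U, φ t = μ t * ψ t := by
  by_cases hz : ∃ s ∈ U, ψ s = 0
  · obtain ⟨s, hs, hψs⟩ := hz
    have hne : ∀ t ∈ U, dslope ψ s t ≠ 0 := by
      intro t ht
      rcases eq_or_ne t s with rfl | hts
      · rw [dslope_same]
        exact hψ' t ht
      · rw [dslope_of_ne _ hts, slope_def_field]
        exact div_ne_zero (sub_ne_zero.2 fun h => hts (hinj ht hs h)) (sub_ne_zero.2 hts)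
    refine ⟨fun t => dslope φ s t / dslope ψ s t,
      ((Complex.differentiableOn_dslope (hU.mem_nhds hs)).2 hφ).fun_div
        ((Complex.differentiableOn_dslope (hU.mem_nhds hs)).2 hψ) hne, fun t ht => ?_⟩
    have h1 := sub_smul_dslope φ s t
    have h2 := sub_smul_dslope ψ s t
    rw [h0 s hs hψs, sub_zero, smul_eq_mul] at h1
    rw [hψs, sub_zero, smul_eq_mul] at h2
    rw [← h1, ← h2]
    have := hne t ht
    field_simp
  · push Not at hz
    refine ⟨fun t => φ t / ψ t, hφ.fun_div hψ hz, fun t ht => ?_⟩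
    have := hz t ht
    field_simp

theorem eq_zero_of_eventually_mul_eq_zero {c α : E → ℂ} {p : E} (hc : ContinuousAt c p)
    (hα : fderiv ℂ α p ≠ 0) (h : ∀ᶠ x in 𝓝 p, c x * α x = 0) : c p = 0 := by
  by_contra hne
  apply hα
  have : α =ᶠ[𝓝 p] fun _ => 0 := by
    filter_upwards [h, hc.eventually_ne hne] with x hx hx'
    exact (mul_eq_zero.1 hx).resolve_left hx'
  rw [this.fderiv_eq]
  simp

theorem eq_zero_of_mul_eventuallyEq_mul {a b α β : E → ℂ} {p : E} (ha : DifferentiableAt ℂ a p)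
    (hb : DifferentiableAt ℂ b p) (hα : DifferentiableAt ℂ α p) (hβ : DifferentiableAt ℂ β p)
    (hli : LinearIndependent ℂ ![fderiv ℂ α p, fderiv ℂ β p])
    (h : ∀ᶠ x in 𝓝 p, a x * β x = b x * α x) (h0 : α p = 0) : a p = 0 := by
  by_contra hne
  have hβ0 : β p = 0 := by
    have := h.self_of_nhds
    rw [h0, mul_zero] at this
    exact (mul_eq_zero.1 this).resolve_left hne
  have h1 : fderiv ℂ (fun x => a x * β x) p = fderiv ℂ (fun x => b x * α x) p :=
    EventuallyEq.fderiv_eq h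
  rw [fderiv_fun_mul ha hβ, fderiv_fun_mul hb hα, h0, hβ0] at h1
  have h2 : a p • fderiv ℂ β p = b p • fderiv ℂ α p := by
    ext v
    simpa using DFunLike.congr_fun h1 v
  have := LinearIndependent.pair_iff.1 hli (b p) (-a p) (by rw [neg_smul, h2]; simp)
  exact hne (neg_eq_zero.1 this.2)

variable [FiniteDimensional ℂ E]

theorem analyticAt_tsum_of_summable_norm {F : Type} [NormedAddCommGroup F] [NormedSpace ℂ F]
    [FiniteDimensional ℂ F] {f : ℕ → E → F} {c : E} {r : ℝ} (hr : 0 < r) {u : ℕ → ℝ}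
    (hf : ∀ k, DifferentiableOn ℂ (f k) (Metric.ball c r))
    (hu : Summable u) (hfu : ∀ k, ∀ x ∈ Metric.ball c r, ‖f k x‖ ≤ u k) :
    AnalyticAt ℂ (fun x => ∑' k, f k x) c := by
  refine analyticAt_of_eventually_differentiableAt ?_
  filter_upwards [Metric.ball_mem_nhds c (half_pos hr)] with x hx
  have hc : c ∈ Metric.ball c (r / 2) := Metric.mem_ball_self (half_pos hr)
  refine (hasFDerivAt_tsum_of_isPreconnected (u := fun k => 2 * u k / (r / 2))
    ((hu.mul_left 2).div_const _) Metric.isOpen_ball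
    (convex_ball c (r / 2)).isPreconnected (f := f) (f' := fun k x => fderiv ℂ (f k) x)
    (fun k y hy => ?_) (fun k y hy => ?_) hc ?_ hx).differentiableAt
  · exact ((hf k).differentiableAt (Metric.isOpen_ball.mem_nhds
      (Metric.ball_subset_ball (by linarith) hy))).hasFDerivAt
  · have hb : Metric.ball y (r / 2) ⊆ Metric.ball c r :=
      Metric.ball_subset_ball' (by linarith [Metric.mem_ball.1 hy])
    exact norm_fderiv_le_of_forall_mem_ball_norm_le (half_pos hr) ((hf k).mono hb)
      fun z hz => hfu k z (hb hz)
  · exact Summable.of_norm_bounded hu fun k => hfu k c (Metric.mem_ball_self hr)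

theorem exists_analyticAt_eq_mul {a b α β : E → ℂ} {p : E} (ha : AnalyticAt ℂ a p)
    (hb : AnalyticAt ℂ b p) (hα : AnalyticAt ℂ α p) (hβ : AnalyticAt ℂ β p)
    (hli : LinearIndependent ℂ ![fderiv ℂ α p, fderiv ℂ β p])
    (h : ∀ᶠ x in 𝓝 p, a x * β x = b x * α x) :
    ∃ q : E → ℂ, AnalyticAt ℂ q p ∧ ∀ᶠ x in 𝓝 p, a x = q x * α x := by
  by_cases h0 : α p = 0
  swap
  · refine ⟨fun x => a x / α x, ha.fun_div hα h0, ?_⟩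
    filter_upwards [hα.continuousAt.eventually_ne h0] with x hx
    field_simp
  obtain ⟨u, hu⟩ : ∃ u, fderiv ℂ α p u = 1 := by
    have hne : fderiv ℂ α p ≠ 0 := hli.ne_zero 0
    obtain ⟨w, hw⟩ := ContinuousLinearMap.exists_ne_zero hne
    exact ⟨(fderiv ℂ α p w)⁻¹ • w, by simp [hw]⟩
  have hli' : ∀ᶠ x in 𝓝 p, LinearIndependent ℂ ![fderiv ℂ α x, fderiv ℂ β x] := by
    have hc : ContinuousAt (fun x => ![fderiv ℂ α x, fderiv ℂ β x]) p := by
      refine continuousAt_pi.2 fun i => ?_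
      fin_cases i
      · exact hα.fderiv.continuousAt
      · exact hβ.fderiv.continuousAt
    exact hc.eventually (isOpen_setOfPred_linearIndependent.mem_nhds hli)
  have hder : ∀ᶠ x in 𝓝 p, ‖fderiv ℂ α x u - 1‖ < 1 / 2 := by
    have hc : ContinuousAt (fun x => ‖fderiv ℂ α x u - 1‖) p :=
      ((hα.fderiv.continuousAt.clm_apply continuousAt_const).sub continuousAt_const).norm
    exact hc.eventually (gt_mem_nhds (by simp [hu]))
  obtain ⟨ε, hε, hball⟩ := Metric.eventually_nhds_iff_ball.1
    (hli'.and <| hder.and <| h.eventually_nhds.and <| ha.eventually_analyticAt.and <|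
      hb.eventually_analyticAt.and <| hα.eventually_analyticAt.and hβ.eventually_analyticAt)
  have hzero : ∀ x ∈ Metric.ball p ε, α x = 0 → a x = 0 := by
    intro x hx hx0
    obtain ⟨h1, -, h2, h3, h4, h5, h6⟩ := hball x hx
    exact eq_zero_of_mul_eventuallyEq_mul h3.differentiableAt h4.differentiableAt
      h5.differentiableAt h6.differentiableAt h1 h2 hx0
  obtain ⟨R, hR, hRu⟩ : ∃ R > 0, 2 * R * ‖u‖ < ε / 2 := by
    refine ⟨ε / (8 * (‖u‖ + 1)), by positivity, ?_⟩
    rw [mul_div_assoc', div_mul_eq_mul_div, div_lt_div_iff₀ (by positivity) (by positivity)]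
    nlinarith [norm_nonneg u]
  have hmem {x : E} (hx : x ∈ Metric.ball p (ε / 2)) {t : ℂ}
      (ht : t ∈ Metric.ball (0 : ℂ) (2 * R)) : x + t • u ∈ Metric.ball p ε := by
    rw [mem_ball_iff_norm] at hx ⊢
    rw [mem_ball_zero_iff] at ht
    calc ‖x + t • u - p‖ = ‖(x - p) + t • u‖ := by congr 1; abel
      _ ≤ ‖x - p‖ + ‖t‖ * ‖u‖ := by rw [← norm_smul]; exact norm_add_le _ _
      _ ≤ ‖x - p‖ + 2 * R * ‖u‖ := by gcongr
      _ < ε := by linarith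
  have hsphere {t : ℂ} (ht : t ∈ Metric.sphere (0 : ℂ) R) : t ∈ Metric.ball (0 : ℂ) (2 * R) := by
    rw [mem_sphere_zero_iff_norm] at ht
    rw [mem_ball_zero_iff]
    linarith
  have hline {x : E} (hx : x ∈ Metric.ball p (ε / 2)) {t : ℂ}
      (ht : t ∈ Metric.ball (0 : ℂ) (2 * R)) :
      HasDerivAt (fun t : ℂ => α (x + t • u)) (fderiv ℂ α (x + t • u) u) t := by
    have h1 := (hball _ (hmem hx ht)).2.2.2.2.2.1.differentiableAt.hasFDerivAt
    have h2 : HasDerivAt (fun t : ℂ => x + t • u) u t := by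
      simpa using ((hasDerivAt_id t).smul_const u).const_add x
    exact h1.comp_hasDerivAt t h2
  have hinj {x : E} (hx : x ∈ Metric.ball p (ε / 2)) :
      Set.InjOn (fun t : ℂ => α (x + t • u)) (Metric.ball 0 (2 * R)) := by
    intro s hs t ht hst
    have := (convex_ball (0 : ℂ) (2 * R)).norm_image_sub_le_of_norm_hasDerivWithin_le
      (f := fun t : ℂ => α (x + t • u) - t) (f' := fun t => fderiv ℂ α (x + t • u) u - 1)
      (C := 1 / 2) (fun t ht => ((hline hx ht).sub (hasDerivAt_id t)).hasDerivWithinAt)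
      (fun t ht => (hball _ (hmem hx ht)).2.1.le) hs ht
    simp only at hst
    rw [hst, sub_sub_sub_cancel_left, norm_sub_rev] at this
    have h3 : ‖t - s‖ = 0 := by linarith [norm_nonneg (t - s)]
    exact (sub_eq_zero.1 (norm_eq_zero.1 h3)).symm
  let f : E × ℂ → ℂ := fun q => a (q.1 + q.2 • u) / (α (q.1 + q.2 • u) * q.2)
  let W : Set (E × ℂ) := {q | q.1 + q.2 • u ∈ Metric.ball p ε} ∩
    (fun q : E × ℂ => α (q.1 + q.2 • u) * q.2) ⁻¹' {0}ᶜ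
  have hW₁ : IsOpen {q : E × ℂ | q.1 + q.2 • u ∈ Metric.ball p ε} :=
    Metric.isOpen_ball.preimage (by fun_prop)
  have hdα : DifferentiableOn ℂ (fun q : E × ℂ => α (q.1 + q.2 • u) * q.2)
      {q : E × ℂ | q.1 + q.2 • u ∈ Metric.ball p ε} := fun q hq =>
    (((hball _ hq).2.2.2.2.2.1.differentiableAt.comp (f := fun q : E × ℂ => q.1 + q.2 • u) q
      (by fun_prop)).mul differentiableAt_snd).differentiableWithinAt
  have hda : DifferentiableOn ℂ (fun q : E × ℂ => a (q.1 + q.2 • u))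
      {q : E × ℂ | q.1 + q.2 • u ∈ Metric.ball p ε} := fun q hq =>
    ((hball _ hq).2.2.2.1.differentiableAt.comp (f := fun q : E × ℂ => q.1 + q.2 • u) q
      (by fun_prop)).differentiableWithinAt
  have hW : IsOpen W := hdα.continuousOn.isOpen_inter_preimage hW₁ isOpen_compl_singleton
  have hf : DifferentiableOn ℂ f W := by
    simp only [f, div_eq_mul_inv]
    exact (hda.mono Set.inter_subset_left).fun_mul
      ((hdα.mono Set.inter_subset_left).fun_inv fun q (hq : q ∈ W) => hq.2)
  have hp : p ∈ Metric.ball p (ε / 2) := Metric.mem_ball_self (half_pos hε)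
  have hpW : ∀ t ∈ Metric.sphere (0 : ℂ) R, (p, t) ∈ W := by
    intro t ht
    have ht0 : t ≠ 0 := by rintro rfl; simp at ht; exact hR.ne ht
    refine ⟨hmem hp (hsphere ht), mul_ne_zero (fun h1 => ?_) ht0⟩
    exact ht0 (hinj hp (hsphere ht) (Metric.mem_ball_self (by positivity)) (by simpa [h0] using h1))
  obtain ⟨r, hr, M, -, hrW⟩ :=
    exists_ball_bound_of_differentiableOn hW hf (isCompact_sphere (0 : ℂ) R) hpW
  refine ⟨fun x => (2 * Real.pi * Complex.I : ℂ)⁻¹ • ∮ t in C(0, R), f (x, t),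
    analyticAt_of_eventually_differentiableAt ?_, ?_⟩
  · filter_upwards [Metric.ball_mem_nhds p hr] with x hx
    exact (differentiableAt_circleIntegral hW hf hR.le fun t ht =>
      (hrW x hx t ht).1).fun_const_smul _
  · filter_upwards [Metric.ball_mem_nhds p hr, Metric.ball_mem_nhds p (half_pos hε)] with x hx hx'
    obtain ⟨μ, hμ, hμeq⟩ := exists_differentiableOn_eq_mul_of_injOn Metric.isOpen_ball
      (φ := fun t : ℂ => a (x + t • u))
      (fun t ht => ((hball _ (hmem hx' ht)).2.2.2.1.differentiableAt.comp
        (f := fun t : ℂ => x + t • u) t (by fun_prop)).differentiableWithinAt)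
      (fun t ht => (hline hx' ht).differentiableAt.differentiableWithinAt) (hinj hx')
      (fun t ht => by
        rw [(hline hx' ht).deriv]
        intro h1
        have := (hball _ (hmem hx' ht)).2.1
        rw [h1] at this
        norm_num at this)
      (fun t ht => hzero _ (hmem hx' ht))
    have h_int : (∮ t in C(0, R), f (x, t)) = ∮ t in C(0, R), (t - 0)⁻¹ • μ t := by
      refine circleIntegral.integral_congr hR.le fun t ht => ?_
      have h1 := (hrW x hx t ht).1.2
      have h2 : α (x + t • u) ≠ 0 ∧ t ≠ 0 := by simpa using h1
      obtain ⟨h3, h4⟩ := h2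
      simp only [f, sub_zero, smul_eq_mul, hμeq t (hsphere ht)]
      field_simp
    have hcauchy := (hμ.mono (Metric.closedBall_subset_ball (by linarith : R < 2 * R))
      ).circleIntegral_sub_inv_smul (Metric.mem_ball_self hR)
    rw [h_int, hcauchy, inv_smul_smul₀ Complex.two_pi_I_ne_zero]
    simpa using hμeq 0 (Metric.mem_ball_self (by positivity))

theorem exists_analyticOnNhd_eq_mul {a b α β : E → ℂ} {U : Set E} (hU : IsOpen U)
    (ha : AnalyticOnNhd ℂ a U) (hb : AnalyticOnNhd ℂ b U) (hα : AnalyticOnNhd ℂ α U)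
    (hβ : AnalyticOnNhd ℂ β U)
    (hli : ∀ p ∈ U, LinearIndependent ℂ ![fderiv ℂ α p, fderiv ℂ β p])
    (h : ∀ x ∈ U, a x * β x = b x * α x) :
    ∃ q : E → ℂ, AnalyticOnNhd ℂ q U ∧ ∀ x ∈ U, a x = q x * α x := by
  have hloc : ∀ p ∈ U, ∃ q : E → ℂ, AnalyticAt ℂ q p ∧ ∀ᶠ x in 𝓝 p, a x = q x * α x :=
    fun p hp => exists_analyticAt_eq_mul (ha p hp) (hb p hp) (hα p hp) (hβ p hp) (hli p hp)
      (by filter_upwards [hU.mem_nhds hp] with x hx using h x hx)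
  choose! q hqa hqe using hloc
  refine ⟨fun p => q p p, fun p hp => (hqa p hp).congr ?_, fun p hp => (hqe p hp).self_of_nhds⟩
  filter_upwards [(hqa p hp).eventually_analyticAt, (hqe p hp).eventually_nhds, hU.mem_nhds hp]
    with x hx1 hx2 hx
  refine sub_eq_zero.1 (eq_zero_of_eventually_mul_eq_zero (c := fun y => q p y - q x y)
    (hx1.continuousAt.sub (hqa x hx).continuousAt) ((hli x hx).ne_zero 0) ?_)
  filter_upwards [hx2, hqe x hx] with y hy1 hy2
  rw [sub_mul, ← hy1, ← hy2, sub_self]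

end Division

section Multiplier

variable {E : Type} [NormedAddCommGroup E] [NormedSpace ℂ E]

theorem AnalyticAt.fderiv_apply_const {f : E → ℂ} {p : E} (hf : AnalyticAt ℂ f p) (v : E) :
    AnalyticAt ℂ (fun x => fderiv ℂ f x v) p :=
  ((ContinuousLinearMap.apply ℂ ℂ v).analyticAt _).comp hf.fderiv

variable [FiniteDimensional ℂ E]

theorem exists_fderiv_eq_mul {ρ f : E → ℂ} {S U : Set E} (hU : IsOpen U)
    (hρ : AnalyticOnNhd ℂ ρ U) (hf : AnalyticOnNhd ℂ f U) {v v' : E} (hv : v ∈ S) (hv' : v' ∈ S)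
    (hli : ∀ p ∈ U, LinearIndependent ℂ
      ![fderiv ℂ (fun x => fderiv ℂ ρ x v) p, fderiv ℂ (fun x => fderiv ℂ ρ x v') p])
    (h : ∀ p ∈ U, ∀ k ∈ S, ∀ l ∈ S,
      fderiv ℂ ρ p l * fderiv ℂ f p k = fderiv ℂ ρ p k * fderiv ℂ f p l) :
    ∃ q : E → ℂ, AnalyticOnNhd ℂ q U ∧
      (∀ p ∈ U, ∀ k ∈ S, fderiv ℂ f p k = q p * fderiv ℂ ρ p k) ∧
      ∀ p ∈ U, ∀ k ∈ S, ∀ l ∈ S,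
        fderiv ℂ ρ p l * fderiv ℂ q p k = fderiv ℂ ρ p k * fderiv ℂ q p l := by
  have hda {f : E → ℂ} (hf : AnalyticOnNhd ℂ f U) (k : E) :
      AnalyticOnNhd ℂ (fun x => fderiv ℂ f x k) U := fun p hp =>
    (hf p hp).fderiv_apply_const k
  obtain ⟨q, hq, hqe⟩ := exists_analyticOnNhd_eq_mul hU (hda hf v) (hda hf v') (hda hρ v)
    (hda hρ v') hli fun x hx => by linear_combination h x hx v hv v' hv'
  have hqS : ∀ p ∈ U, ∀ k ∈ S, fderiv ℂ f p k = q p * fderiv ℂ ρ p k := by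
    intro p hp k hk
    refine sub_eq_zero.1 (eq_zero_of_eventually_mul_eq_zero
      (c := fun y => fderiv ℂ f y k - q y * fderiv ℂ ρ y k)
      (((hda hf k p hp).continuousAt).sub ((hq p hp).mul (hda hρ k p hp)).continuousAt)
      ((hli p hp).ne_zero 0) ?_)
    filter_upwards [hU.mem_nhds hp] with x hx
    linear_combination h x hx k hk v hv + fderiv ℂ ρ x k * hqe x hx
  refine ⟨q, hq, hqS, fun p hp k hk l hl => ?_⟩
  have hsymm {f : E → ℂ} (hf : AnalyticOnNhd ℂ f U) (k l : E) :
      fderiv ℂ (fun x => fderiv ℂ f x k) p l = fderiv ℂ (fun x => fderiv ℂ f x l) p k := by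
    have h1 := (hf p hp).fderiv.differentiableAt
    rw [fderiv_clm_apply h1 (differentiableAt_const _),
      fderiv_clm_apply h1 (differentiableAt_const _)]
    simpa using ((hf p hp).contDiffAt (n := 2)).isSymmSndFDerivAt (by simp) l k
  have hprod (k l : E) (hk : k ∈ S) : fderiv ℂ (fun x => fderiv ℂ f x k) p l =
      q p * fderiv ℂ (fun x => fderiv ℂ ρ x k) p l + fderiv ℂ ρ p k * fderiv ℂ q p l := by
    have h1 : (fun x => fderiv ℂ f x k) =ᶠ[𝓝 p] fun x => q x * fderiv ℂ ρ x k := by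
      filter_upwards [hU.mem_nhds hp] with x hx using hqS x hx k hk
    rw [h1.fderiv_eq, fderiv_fun_mul (hq p hp).differentiableAt (hda hρ k p hp).differentiableAt]
    simp
  have h1 := hprod k l hk
  have h2 := hprod l k hl
  rw [hsymm hf k l, hsymm hρ k l] at h1
  linear_combination h1 - h2

theorem exists_seq_fderiv_eq_mul {ρ g : E → ℂ} {S U : Set E} (hU : IsOpen U)
    (hρ : AnalyticOnNhd ℂ ρ U) (hg : AnalyticOnNhd ℂ g U) {v v' : E} (hv : v ∈ S) (hv' : v' ∈ S)
    (hli : ∀ p ∈ U, LinearIndependent ℂ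
      ![fderiv ℂ (fun x => fderiv ℂ ρ x v) p, fderiv ℂ (fun x => fderiv ℂ ρ x v') p])
    (h : ∀ p ∈ U, ∀ k ∈ S, ∀ l ∈ S,
      fderiv ℂ ρ p l * fderiv ℂ g p k = fderiv ℂ ρ p k * fderiv ℂ g p l) :
    ∃ f : ℕ → E → ℂ, f 0 = g ∧ (∀ j, AnalyticOnNhd ℂ (f j) U) ∧
      ∀ j, ∀ p ∈ U, ∀ k ∈ S, fderiv ℂ (f j) p k = f (j + 1) p * fderiv ℂ ρ p k := by
  let P : Type := {f : E → ℂ // AnalyticOnNhd ℂ f U ∧ ∀ p ∈ U, ∀ k ∈ S, ∀ l ∈ S,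
    fderiv ℂ ρ p l * fderiv ℂ f p k = fderiv ℂ ρ p k * fderiv ℂ f p l}
  have hnext : ∀ f : P, ∃ q : P, ∀ p ∈ U, ∀ k ∈ S,
      fderiv ℂ f.1 p k = q.1 p * fderiv ℂ ρ p k := fun f =>
    let ⟨q, hq, hqf, hqc⟩ := exists_fderiv_eq_mul hU hρ f.2.1 hv hv' hli f.2.2
    ⟨⟨q, hq, hqc⟩, hqf⟩
  choose next hn using hnext
  exact ⟨fun j => (Nat.rec ⟨g, hg, h⟩ (fun _ f => next f) j : P).1, rfl, fun j =>
    (Nat.rec ⟨g, hg, h⟩ (fun _ f => next f) j : P).2.1, fun j => hn _⟩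

theorem norm_le_mul_pow_of_hasDerivAt {f : ℕ → ℂ → ℂ} {α : ℂ → ℂ} {c δ M : ℝ} (hc : 0 < c)
    (hδ : 0 < δ) (k : ℕ) {z : ℂ} {r : ℝ} (hr : k * δ < r)
    (hf : ∀ j, ∀ t ∈ Metric.ball z r, HasDerivAt (f j) (f (j + 1) t * α t) t)
    (hα : ∀ t ∈ Metric.ball z r, c ≤ ‖α t‖) (hM : ∀ t ∈ Metric.ball z r, ‖f 0 t‖ ≤ M) :
    ‖f k z‖ ≤ M * (1 / (c * δ)) ^ k := by
  induction k generalizing z r with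
  | zero => simpa using hM z (Metric.mem_ball_self (by simpa using hr))
  | succ k ih =>
    push_cast at hr
    have hkδ : 0 ≤ k * δ := by positivity
    have hz : z ∈ Metric.ball z r := Metric.mem_ball_self (by linarith)
    have hsub : Metric.closedBall z δ ⊆ Metric.ball z r :=
      Metric.closedBall_subset_ball (by linarith)
    have hd : DiffContOnCl ℂ (f k) (Metric.ball z δ) := by
      refine DifferentiableOn.diffContOnCl fun t ht => ?_
      rw [closure_ball _ hδ.ne'] at ht
      exact (hf k t (hsub ht)).differentiableAt.differentiableWithinAt
    have h1 := Complex.norm_deriv_le_of_forall_mem_sphere_norm_le hδ hd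
      (C := M * (1 / (c * δ)) ^ k) fun t ht => by
        have hb : Metric.ball t (r - δ) ⊆ Metric.ball z r :=
          Metric.ball_subset_ball' (by rw [Metric.mem_sphere.1 ht]; linarith)
        exact ih (r := r - δ) (by linarith) (fun j s hs => hf j s (hb hs))
          (fun s hs => hα s (hb hs)) fun s hs => hM s (hb hs)
    rw [(hf k z hz).deriv, norm_mul] at h1
    have h2 : ‖f (k + 1) z‖ * c ≤ M * (1 / (c * δ)) ^ k / δ :=
      (mul_le_mul_of_nonneg_left (hα z hz) (norm_nonneg _)).trans h1
    calc ‖f (k + 1) z‖ ≤ M * (1 / (c * δ)) ^ k / δ / c := (le_div_iff₀ hc).2 h2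
      _ = M * (1 / (c * δ)) ^ (k + 1) := by rw [pow_succ]; field_simp

theorem norm_le_mul_factorial_of_hasDerivAt {f : ℕ → ℂ → ℂ} {α : ℂ → ℂ} {c M r : ℝ} (hc : 0 < c)
    (hr : 0 < r) {z : ℂ}
    (hf : ∀ j, ∀ t ∈ Metric.ball z r, HasDerivAt (f j) (f (j + 1) t * α t) t)
    (hα : ∀ t ∈ Metric.ball z r, c ≤ ‖α t‖) (hM : ∀ t ∈ Metric.ball z r, ‖f 0 t‖ ≤ M) (k : ℕ) :
    ‖f k z‖ ≤ M * Real.exp 1 * (Real.exp 1 / (c * r)) ^ k * k.factorial := by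
  have hM0 : 0 ≤ M := (norm_nonneg _).trans (hM z (Metric.mem_ball_self hr))
  have h1 := norm_le_mul_pow_of_hasDerivAt hc (δ := r / (k + 1)) (by positivity) k
    (by rw [mul_div_assoc', div_lt_iff₀ (by positivity)]; nlinarith) hf hα hM
  have h2 := Real.pow_div_factorial_le_exp (k + 1 : ℝ) (by positivity) k
  rw [div_le_iff₀ (by positivity)] at h2
  calc ‖f k z‖ ≤ M * (1 / (c * (r / (k + 1)))) ^ k := h1
    _ = M * ((k + 1 : ℝ) ^ k / (c * r) ^ k) := by
      rw [← div_pow]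
      congr 2
      field_simp
    _ ≤ M * (Real.exp (k + 1) * k.factorial / (c * r) ^ k) := by gcongr
    _ = M * Real.exp 1 * (Real.exp 1 / (c * r)) ^ k * k.factorial := by
      rw [div_pow, ← Real.exp_nat_mul, mul_one, Real.exp_add]
      ring

theorem exists_ball_norm_le_mul_factorial {ρ : E → ℂ} {f : ℕ → E → ℂ} {U : Set E} {v p₀ : E}
    (hU : IsOpen U) (hp₀ : p₀ ∈ U) (hρ : AnalyticOnNhd ℂ ρ U) (hf : ∀ j, AnalyticOnNhd ℂ (f j) U)
    (hfd : ∀ j, ∀ p ∈ U, fderiv ℂ (f j) p v = f (j + 1) p * fderiv ℂ ρ p v)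
    (hv : fderiv ℂ (fun x => fderiv ℂ ρ x v) p₀ ≠ 0) :
    ∃ δ > 0, ∃ M > 0, ∃ L > 0, Metric.ball p₀ δ ⊆ U ∧
      ∀ p ∈ Metric.ball p₀ δ, ∀ k, ‖f k p‖ ≤ M * L ^ k * k.factorial := by
  obtain ⟨u, hu⟩ := ContinuousLinearMap.exists_ne_zero hv
  set α : E → ℂ := fun x => fderiv ℂ ρ x v with hα
  have hαa : AnalyticOnNhd ℂ α U := fun p hp => (hρ p hp).fderiv_apply_const v
  have hline (p : E) (w : E) (t : ℂ) : HasDerivAt (fun t : ℂ => p + t • w) w t := by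
    simpa using ((hasDerivAt_id t).smul_const w).const_add p
  have hcl (p : E) (w : E) : Continuous fun t : ℂ => p + t • w := by fun_prop
  have hd0 : HasDerivAt (fun t : ℂ => α (p₀ + t • u)) (fderiv ℂ α p₀ u) 0 := by
    refine HasFDerivAt.comp_hasDerivAt (l := α) 0 ?_ (hline p₀ u 0)
    simpa using (hαa p₀ hp₀).differentiableAt.hasFDerivAt
  obtain ⟨R, hR, hRU⟩ : ∃ R > 0, ∀ t ∈ Metric.closedBall (0 : ℂ) R,
      p₀ + t • u ∈ U ∧ (t ≠ 0 → α (p₀ + t • u) ≠ 0) := by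
    have h1 := eventually_nhdsWithin_iff.1 (hd0.eventually_ne (c := 0) hu)
    have h2 : ∀ᶠ t in 𝓝 (0 : ℂ), p₀ + t • u ∈ U :=
      (hcl p₀ u).continuousAt.eventually_mem (hU.mem_nhds (by simpa))
    exact Metric.nhds_basis_closedBall.eventually_iff.1 (h2.and h1)
  let V : Set E := U ∩ α ⁻¹' {0}ᶜ
  have hV : IsOpen V := hαa.continuousOn.isOpen_inter_preimage hU isOpen_compl_singleton
  obtain ⟨η, hη, hηU⟩ := ((isCompact_closedBall (0 : ℂ) R).image (hcl p₀ u)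
    ).exists_thickening_subset_open hU (by rintro _ ⟨t, ht, rfl⟩; exact (hRU t ht).1)
  have hKV : (fun t : ℂ => p₀ + t • u) '' Metric.sphere 0 R ⊆ V := by
    rintro _ ⟨t, ht, rfl⟩
    have h1 := hRU t (Metric.sphere_subset_closedBall ht)
    refine ⟨h1.1, h1.2 ?_⟩
    rintro rfl
    simp at ht
    exact hR.ne ht
  have : ProperSpace E := FiniteDimensional.proper ℂ E
  obtain ⟨η', hη', hηV⟩ := ((isCompact_sphere (0 : ℂ) R).image (hcl p₀ u)
    ).exists_cthickening_subset_open hV hKV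
  have hcomp : IsCompact (Metric.cthickening η' ((fun t : ℂ => p₀ + t • u) '' Metric.sphere 0 R)) :=
    ((isCompact_sphere (0 : ℂ) R).image (hcl p₀ u)).cthickening
  obtain ⟨C, hC⟩ := hcomp.exists_bound_of_continuousOn (f := fun x => (α x)⁻¹)
    ((hαa.continuousOn.mono (hηV.trans Set.inter_subset_left)).inv₀ fun x hx => (hηV hx).2)
  obtain ⟨M, hM⟩ := hcomp.exists_bound_of_continuousOn (f := f 0)
    ((hf 0).continuousOn.mono (hηV.trans Set.inter_subset_left))
  set c : ℝ := 1 / (|C| + 1) with hcdef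
  have hc : 0 < c := by positivity
  set r : ℝ := η' / (2 * (‖v‖ + 1)) with hrdef
  have hr : 0 < r := by positivity
  have hrv : r * ‖v‖ ≤ η' / 2 := by
    rw [hrdef, div_mul_eq_mul_div, div_le_div_iff₀ (by positivity) (by positivity)]
    nlinarith [norm_nonneg v]
  have hdist (p : E) (t : ℂ) : dist (p + t • u) (p₀ + t • u) = dist p p₀ := dist_add_right _ _ _
  have hbound {p : E} (hp : dist p p₀ < η' / 2) {t : ℂ} (ht : t ∈ Metric.sphere (0 : ℂ) R) (k : ℕ) :
      ‖f k (p + t • u)‖ ≤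
        (|M| + 1) * Real.exp 1 * (Real.exp 1 / (c * r)) ^ k * k.factorial := by
    have hmem : ∀ s ∈ Metric.ball (0 : ℂ) r, p + t • u + s • v ∈
        Metric.cthickening η' ((fun t : ℂ => p₀ + t • u) '' Metric.sphere 0 R) := by
      intro s hs
      refine Metric.mem_cthickening_of_dist_le _ (p₀ + t • u) _ _ ⟨t, ht, rfl⟩ ?_
      rw [mem_ball_zero_iff] at hs
      calc dist (p + t • u + s • v) (p₀ + t • u)
          ≤ dist (p + t • u + s • v) (p + t • u) + dist (p + t • u) (p₀ + t • u) :=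
            dist_triangle _ _ _
        _ = ‖s‖ * ‖v‖ + dist p p₀ := by rw [hdist, dist_eq_norm, add_sub_cancel_left, norm_smul]
        _ ≤ r * ‖v‖ + η' / 2 := by gcongr
        _ ≤ η' := by linarith
    have := norm_le_mul_factorial_of_hasDerivAt (f := fun j s => f j (p + t • u + s • v))
      (α := fun s => α (p + t • u + s • v)) (z := 0) (M := |M| + 1) hc hr
      (fun j s hs => ?_) (fun s hs => ?_) (fun s hs => ?_) k
    · simpa using this
    · have hsU := (hηV (hmem s hs)).1
      rw [← hfd j _ hsU]
      exact (hf j _ hsU).differentiableAt.hasFDerivAt.comp_hasDerivAt s (hline _ v s)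
    · have h1 := hC _ (hmem s hs)
      have h2 : α (p + t • u + s • v) ≠ 0 := (hηV (hmem s hs)).2
      rw [norm_inv] at h1
      rw [hcdef, one_div]
      refine inv_le_of_inv_le₀ (norm_pos_iff.2 h2) (h1.trans ?_)
      linarith [le_abs_self C]
    · linarith [hM _ (hmem s hs), le_abs_self M]
  have hlineU {p : E} (hp : dist p p₀ < η) {t : ℂ} (ht : t ∈ Metric.closedBall (0 : ℂ) R) :
      p + t • u ∈ U :=
    hηU (Metric.mem_thickening_iff.2 ⟨_, ⟨t, ht, rfl⟩, by rw [hdist]; exact hp⟩)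
  have hR0 : (0 : ℂ) ∈ Metric.closedBall (0 : ℂ) R := Metric.mem_closedBall_self hR.le
  refine ⟨min η (η' / 2), by positivity, (|M| + 1) * Real.exp 1, by positivity,
    Real.exp 1 / (c * r), by positivity, fun p hp => ?_, fun p hp k => ?_⟩
  · simpa using hlineU ((Metric.mem_ball.1 hp).trans_le (min_le_left _ _)) hR0
  · have hp1 := (Metric.mem_ball.1 hp).trans_le (min_le_left _ _)
    have hp2 := (Metric.mem_ball.1 hp).trans_le (min_le_right _ _)
    have := Complex.norm_le_of_forall_mem_frontier_norm_le (f := fun t : ℂ => f k (p + t • u))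
      (U := Metric.ball 0 R) Metric.isBounded_ball
      (DifferentiableOn.diffContOnCl fun t ht => by
        rw [closure_ball _ hR.ne'] at ht
        exact ((hf k _ (hlineU hp1 ht)).differentiableAt.comp (f := fun t : ℂ => p + t • u) t
          (hline p u t).differentiableAt).differentiableWithinAt)
      (fun t ht => hbound hp2 (by rwa [frontier_ball _ hR.ne'] at ht) k)
      (subset_closure (Metric.mem_ball_self hR))
    simpa using this

end Multiplier

section Factorization

theorem hasDerivAt_sum_div_factorial_mul_pow {φ : ℕ → ℂ → ℂ} {ψ : ℂ → ℂ} {r s : ℂ}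
    (hφ : ∀ j, HasDerivAt (φ j) (φ (j + 1) s * r) s) (hψ : HasDerivAt ψ (-r) s) (N : ℕ) :
    HasDerivAt (fun s => ∑ j ∈ Finset.range (N + 1), φ j s / j.factorial * ψ s ^ j)
      (φ (N + 1) s * r * ψ s ^ N / N.factorial) s := by
  induction N with
  | zero => simpa using hφ 0
  | succ N ih =>
    simp only [Finset.sum_range_succ _ (N + 1)]
    refine (ih.add (((hφ (N + 1)).div_const _).mul (hψ.pow (N + 1)))).congr_deriv ?_
    have h1 : (N.factorial : ℂ) ≠ 0 := by exact_mod_cast N.factorial_ne_zero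
    have h2 : (N + 1 : ℂ) ≠ 0 := by exact_mod_cast N.succ_ne_zero
    rw [Nat.factorial_succ]
    push_cast
    simp only [Pi.pow_apply]
    field_simp
    ring

variable {Z : Type} [NormedAddCommGroup Z] [NormedSpace ℂ Z] [FiniteDimensional ℂ Z]

theorem exists_analyticAt_eq_comp {ρ g : Z × Z → ℂ} (hρ : AnalyticAt ℂ ρ 0)
    (hg : AnalyticAt ℂ g 0) (hρ0 : ρ 0 = 0) {v v' : Z}
    (hli : LinearIndependent ℂ ![fderiv ℂ (fun x => fderiv ℂ ρ x (0, v)) 0,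
      fderiv ℂ (fun x => fderiv ℂ ρ x (0, v')) 0])
    (h : ∀ᶠ p in 𝓝 (0 : Z × Z), ∀ k l : Z, fderiv ℂ ρ p (0, l) * fderiv ℂ g p (0, k) =
      fderiv ℂ ρ p (0, k) * fderiv ℂ g p (0, l)) :
    ∃ h : Z × ℂ → ℂ, AnalyticAt ℂ h 0 ∧ ∀ᶠ p in 𝓝 (0 : Z × Z), g p = h (p.1, ρ p) := by
  have hli' : ∀ᶠ p in 𝓝 (0 : Z × Z), LinearIndependent ℂ
      ![fderiv ℂ (fun x => fderiv ℂ ρ x (0, v)) p,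
        fderiv ℂ (fun x => fderiv ℂ ρ x (0, v')) p] := by
    have hc : ContinuousAt (fun p => ![fderiv ℂ (fun x => fderiv ℂ ρ x (0, v)) p,
        fderiv ℂ (fun x => fderiv ℂ ρ x (0, v')) p]) 0 := by
      refine continuousAt_pi.2 fun i => ?_
      fin_cases i
      · exact (hρ.fderiv_apply_const (0, v)).fderiv.continuousAt
      · exact (hρ.fderiv_apply_const (0, v')).fderiv.continuousAt
    exact hc.eventually (isOpen_setOfPred_linearIndependent.mem_nhds hli)
  obtain ⟨ε₀, hε₀, hball⟩ := Metric.eventually_nhds_iff_ball.1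
    (hli'.and <| h.and <| hρ.eventually_analyticAt.and hg.eventually_analyticAt)
  have hρa : AnalyticOnNhd ℂ ρ (Metric.ball 0 ε₀) := fun p hp => (hball p hp).2.2.1
  obtain ⟨f, rfl, hfa, hfd⟩ := exists_seq_fderiv_eq_mul (S := Set.range fun k : Z => ((0 : Z), k))
    Metric.isOpen_ball hρa
    (fun p hp => (hball p hp).2.2.2) ⟨v, rfl⟩ ⟨v', rfl⟩ (fun p hp => (hball p hp).1)
    (by
      rintro p hp _ ⟨k, rfl⟩ _ ⟨l, rfl⟩
      exact (hball p hp).2.1 k l)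
  obtain ⟨δ, hδ, M, hM, L, hL, hδU, hbound⟩ := exists_ball_norm_le_mul_factorial (v := (0, v))
    Metric.isOpen_ball (Metric.mem_ball_self hε₀) hρa hfa (fun j p hp => hfd j p hp _ ⟨v, rfl⟩)
    (hli.ne_zero 0)
  obtain ⟨K, hK⟩ : ∃ K, ‖fderiv ℂ ρ 0‖ < K := exists_gt _
  have hsmall : ∀ᶠ p in 𝓝 (0 : Z × Z), ‖ρ p‖ < 1 / (8 * L) ∧ ‖fderiv ℂ ρ p‖ < K :=
    (hρ.continuousAt.norm.eventually (gt_mem_nhds (by simp only [hρ0, norm_zero]; positivity))).and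
      (hρ.fderiv.continuousAt.norm.eventually (gt_mem_nhds hK))
  obtain ⟨ε₁, hε₁, hball₁⟩ := Metric.eventually_nhds_iff_ball.1
    (hsmall.and (Metric.ball_mem_nhds 0 hδ))
  have hK0 : 0 ≤ K := (norm_nonneg _).trans hK.le
  have hterm {a b : ℂ} {j : ℕ} (ha : ‖a‖ ≤ M * L ^ j * j.factorial) (hb : ‖b‖ ≤ 1 / (4 * L)) :
      ‖a / j.factorial * b ^ j‖ ≤ M * (1 / 4) ^ j := by
    rw [norm_mul, norm_div, norm_pow, Complex.norm_natCast]
    calc ‖a‖ / j.factorial * ‖b‖ ^ j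
        ≤ (M * L ^ j * j.factorial) / j.factorial * (1 / (4 * L)) ^ j := by gcongr
      _ = M * (1 / 4) ^ j := by
        rw [mul_div_cancel_right₀ _ (by positivity), mul_assoc, ← mul_pow]
        congr 2
        field_simp
  have hsum : Summable fun j : ℕ => M * (1 / 4 : ℝ) ^ j :=
    (summable_geometric_of_lt_one (by norm_num) (by norm_num)).mul_left M
  let F : ℕ → Z × ℂ → ℂ := fun j q => f j (q.1, 0) / j.factorial * (q.2 - ρ (q.1, 0)) ^ j
  have hmem {z : Z} (hz : ‖z‖ < ε₁) : (z, (0 : Z)) ∈ Metric.ball (0 : Z × Z) ε₁ := by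
    rw [mem_ball_zero_iff, Prod.norm_def]
    simpa using hz
  have hFb (z : Z) (hz : ‖z‖ < ε₁) (w : ℂ) (hw : ‖w‖ < 1 / (8 * L)) (j : ℕ) :
      ‖F j (z, w)‖ ≤ M * (1 / 4) ^ j := by
    refine hterm (hbound _ (hball₁ _ (hmem hz)).2 j) ?_
    calc ‖w - ρ (z, 0)‖ ≤ ‖w‖ + ‖ρ (z, 0)‖ := norm_sub_le _ _
      _ ≤ 1 / (8 * L) + 1 / (8 * L) := add_le_add hw.le (hball₁ _ (hmem hz)).1.1.le
      _ = 1 / (4 * L) := by field_simp; norm_num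
  refine ⟨fun q => ∑' j, F j q, analyticAt_tsum_of_summable_norm
    (r := min ε₁ (1 / (8 * L))) (by positivity) (fun j q hq => ?_) hsum (fun j q hq => ?_), ?_⟩
  · rw [mem_ball_zero_iff, lt_min_iff] at hq
    have hq1 : (q.1, (0 : Z)) ∈ Metric.ball (0 : Z × Z) ε₀ :=
      hδU (hball₁ _ (hmem ((norm_fst_le q).trans_lt hq.1))).2
    have h1 : DifferentiableAt ℂ (fun q : Z × ℂ => (q.1, (0 : Z))) q := by fun_prop
    have h2 := (hfa j _ hq1).differentiableAt.comp (f := fun q : Z × ℂ => (q.1, (0 : Z))) q h1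
    have h3 := (hρa _ hq1).differentiableAt.comp (f := fun q : Z × ℂ => (q.1, (0 : Z))) q h1
    simp only [F, div_eq_mul_inv]
    exact ((h2.mul_const _).fun_mul ((differentiableAt_snd.fun_sub h3).fun_pow j)
      ).differentiableWithinAt
  · rw [mem_ball_zero_iff, lt_min_iff] at hq
    exact hFb q.1 ((norm_fst_le q).trans_lt hq.1) q.2 ((norm_snd_le q).trans_lt hq.2) j
  · filter_upwards [Metric.ball_mem_nhds (0 : Z × Z) hε₁] with p hp
    obtain ⟨z, ζ⟩ := p
    have hseg {s : ℂ} (hs : s ∈ Metric.closedBall (0 : ℂ) 1) :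
        (z, s • ζ) ∈ Metric.ball (0 : Z × Z) ε₁ := by
      rw [mem_closedBall_zero_iff] at hs
      rw [mem_ball_zero_iff, Prod.norm_def, max_lt_iff] at hp ⊢
      refine ⟨hp.1, ?_⟩
      rw [norm_smul]
      exact (mul_le_of_le_one_left (norm_nonneg _) hs).trans_lt hp.2
    have hpath (s : ℂ) : HasDerivAt (fun s : ℂ => (z, s • ζ)) ((0 : Z), ζ) s := by
      simpa using (hasDerivAt_const s z).prodMk ((hasDerivAt_id s).smul_const ζ)
    let P : ℕ → ℂ → ℂ := fun N s => ∑ j ∈ Finset.range (N + 1),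
      f j (z, s • ζ) / j.factorial * (ρ (z, ζ) - ρ (z, s • ζ)) ^ j
    have hP (N : ℕ) {s : ℂ} (hs : s ∈ Metric.closedBall (0 : ℂ) 1) :
        HasDerivAt (P N) (f (N + 1) (z, s • ζ) * fderiv ℂ ρ (z, s • ζ) (0, ζ) *
          (ρ (z, ζ) - ρ (z, s • ζ)) ^ N / N.factorial) s := by
      have hU := hδU (hball₁ _ (hseg hs)).2
      refine hasDerivAt_sum_div_factorial_mul_pow (φ := fun j s => f j (z, s • ζ))
        (ψ := fun s => ρ (z, ζ) - ρ (z, s • ζ)) (r := fderiv ℂ ρ (z, s • ζ) (0, ζ))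
        (fun j => ?_) ?_ N
      · rw [← hfd j _ hU _ ⟨ζ, rfl⟩]
        exact (hfa j _ hU).differentiableAt.hasFDerivAt.comp_hasDerivAt s (hpath s)
      · exact ((hρa _ hU).differentiableAt.hasFDerivAt.comp_hasDerivAt s (hpath s)).const_sub _
    have hPb (N : ℕ) {s : ℂ} (hs : s ∈ Metric.closedBall (0 : ℂ) 1) :
        ‖f (N + 1) (z, s • ζ) * fderiv ℂ ρ (z, s • ζ) (0, ζ) *
          (ρ (z, ζ) - ρ (z, s • ζ)) ^ N / N.factorial‖ ≤
        M * L * K * ‖ζ‖ * ((N + 1 : ℝ) * (1 / 4) ^ N) := by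
      have h1 := hball₁ _ (hseg hs)
      have h2 : ‖fderiv ℂ ρ (z, s • ζ) (0, ζ)‖ ≤ K * ‖ζ‖ :=
        ((fderiv ℂ ρ (z, s • ζ)).le_opNorm _).trans (by
          rw [Prod.norm_mk, norm_zero, max_eq_right (norm_nonneg _)]
          gcongr
          exact h1.1.2.le)
      have h3 : ‖ρ (z, ζ) - ρ (z, s • ζ)‖ ≤ 1 / (4 * L) :=
        calc ‖ρ (z, ζ) - ρ (z, s • ζ)‖ ≤ ‖ρ (z, ζ)‖ + ‖ρ (z, s • ζ)‖ := norm_sub_le _ _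
          _ ≤ 1 / (8 * L) + 1 / (8 * L) := add_le_add (hball₁ _ hp).1.1.le h1.1.1.le
          _ = 1 / (4 * L) := by field_simp; norm_num
      rw [norm_div, norm_mul, norm_mul, norm_pow, Complex.norm_natCast]
      calc _ ≤ M * L ^ (N + 1) * (N + 1).factorial * (K * ‖ζ‖) * (1 / (4 * L)) ^ N /
            N.factorial := by gcongr; exact hbound _ h1.2 _
        _ = _ := by
          rw [Nat.factorial_succ, div_pow, div_pow, mul_pow, one_pow, pow_succ]
          push_cast
          field_simp
    have h0 : (0 : ℂ) ∈ Metric.closedBall (0 : ℂ) 1 := by simp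
    have h1 : (1 : ℂ) ∈ Metric.closedBall (0 : ℂ) 1 := by simp
    have hdiff (N : ℕ) : ‖f 0 (z, ζ) - P N 0‖ ≤
        M * L * K * ‖ζ‖ * ((N + 1 : ℝ) * (1 / 4) ^ N) := by
      have := (convex_closedBall (0 : ℂ) 1).norm_image_sub_le_of_norm_hasDerivWithin_le
        (fun s hs => (hP N hs).hasDerivWithinAt) (fun s hs => hPb N hs) h0 h1
      rw [sub_zero, norm_one, mul_one] at this
      have hP1 : P N 1 = f 0 (z, ζ) := by simp [P, Finset.sum_range_succ']
      rwa [hP1] at this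
    have hlim : Tendsto (fun N : ℕ => M * L * K * ‖ζ‖ * ((N + 1 : ℝ) * (1 / 4 : ℝ) ^ N)) atTop
        (𝓝 0) := by
      have h1 := tendsto_self_mul_const_pow_of_lt_one (r := (1 / 4 : ℝ)) (by norm_num) (by norm_num)
      have h2 := tendsto_pow_atTop_nhds_zero_of_lt_one (r := (1 / 4 : ℝ)) (by norm_num)
        (by norm_num)
      have h3 := (h1.add h2).const_mul (M * L * K * ‖ζ‖)
      rw [add_zero, mul_zero] at h3
      refine h3.congr fun N => ?_
      ring
    have hlim1 : Tendsto (fun N => P N 0) atTop (𝓝 (f 0 (z, ζ))) := by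
      refine tendsto_iff_norm_sub_tendsto_zero.2 (squeeze_zero (fun _ => norm_nonneg _)
        (fun N => ?_) hlim)
      rw [norm_sub_rev]
      exact hdiff N
    have hz : ‖z‖ < ε₁ := by
      rw [mem_ball_zero_iff] at hp
      exact (norm_fst_le (z, ζ)).trans_lt hp
    have hlim2 : Tendsto (fun N => P N 0) atTop (𝓝 (∑' j, F j (z, ρ (z, ζ)))) := by
      have h1 := (Summable.of_norm_bounded hsum (hFb z hz (ρ (z, ζ)) (hball₁ _ hp).1.1)
        ).hasSum.tendsto_sum_nat
      refine ((tendsto_add_atTop_iff_nat 1).2 h1).congr fun N => ?_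
      simp [P, F]
    exact tendsto_nhds_unique hlim1 hlim2

end Factorization

section Jet

theorem eq_zero_of_pow_mul_isBigO {f : ℝ → ℂ} {k : ℕ} (hf : ContinuousAt f 0)
    (h : (fun t : ℝ => (t : ℂ) ^ k * f t) =O[𝓝 0] fun t => t ^ (k + 1)) : f 0 = 0 := by
  obtain ⟨C, hC⟩ := h.bound
  have h1 : Tendsto f (𝓝[≠] 0) (𝓝 0) := by
    refine squeeze_zero_norm' (a := fun t : ℝ => C * |t|) ?_ ?_
    · filter_upwards [hC.filter_mono nhdsWithin_le_nhds, self_mem_nhdsWithin] with t ht ht0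
      rw [norm_mul, norm_pow, norm_pow, Complex.norm_real, Real.norm_eq_abs, pow_succ] at ht
      have : 0 < |t| ^ k := pow_pos (abs_pos.2 ht0) k
      refine le_of_mul_le_mul_left ?_ this
      linarith
    · have : Continuous fun t : ℝ => C * |t| := by fun_prop
      simpa using (this.tendsto 0).mono_left (nhdsWithin_le_nhds (s := {0}ᶜ))
  exact tendsto_nhds_unique (hf.tendsto.mono_left nhdsWithin_le_nhds) h1

theorem eq_zero_of_quadratic_isBigO {a b c : ℂ}
    (h : (fun t : ℝ => a + t * b + (t : ℂ) ^ 2 * c) =O[𝓝 0] fun t => t ^ 3) :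
    a = 0 ∧ b = 0 ∧ c = 0 := by
  have hpow {k : ℕ} (hk : k ≤ 3) : (fun t : ℝ => t ^ 3) =O[𝓝 0] fun t => t ^ k :=
    IsBigO.of_bound 1 <| by
      filter_upwards [Metric.closedBall_mem_nhds (0 : ℝ) one_pos] with t ht
      rw [mem_closedBall_zero_iff] at ht
      rw [norm_pow, norm_pow, one_mul]
      exact pow_le_pow_of_le_one (norm_nonneg _) ht hk
  have ha : a = 0 := by
    have := eq_zero_of_pow_mul_isBigO (k := 0)
      (f := fun t : ℝ => a + t * b + (t : ℂ) ^ 2 * c) (by fun_prop)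
      ((h.trans (hpow (by norm_num : 1 ≤ 3))).congr_left fun t => by simp)
    push_cast at this
    linear_combination this
  subst ha
  have hb : b = 0 := by
    simpa using eq_zero_of_pow_mul_isBigO (k := 1) (f := fun t : ℝ => b + t * c) (by fun_prop)
      ((h.trans (hpow (by norm_num : 2 ≤ 3))).congr_left fun t => by ring)
  subst hb
  have hc : c = 0 :=
    eq_zero_of_pow_mul_isBigO (k := 2) (f := fun _ : ℝ => c) (by fun_prop)
      (h.congr_left fun t => by ring)
  exact ⟨rfl, rfl, hc⟩

variable {E : Type} [NormedAddCommGroup E] [NormedSpace ℂ E]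

theorem isBigO_sub_taylor_two {f : E → ℂ} (hf : AnalyticAt ℂ f 0) (v : E) :
    (fun t : ℝ => f ((t : ℂ) • v) -
      (f 0 + t * fderiv ℂ f 0 v + (t : ℂ) ^ 2 * (fderiv ℂ (fderiv ℂ f) 0 v v / 2)))
      =O[𝓝 0] fun t => t ^ 3 := by
  obtain ⟨p, r, hp⟩ := hf
  have h1 := hp.hasFPowerSeriesAt.isBigO_sub_partialSum_pow 3
  have hlim : Tendsto (fun t : ℝ => (t : ℂ) • v) (𝓝 0) (𝓝 0) := by
    have : Continuous fun t : ℝ => (t : ℂ) • v := by fun_prop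
    simpa using this.tendsto 0
  have h2 := h1.comp_tendsto hlim
  have h0 (y : E) : p 0 (fun _ => y) = f 0 := by
    simpa using hp.factorial_smul (n := 0) y
  have h1 (y : E) : p 1 (fun _ => y) = fderiv ℂ f 0 y := by
    simpa using hp.factorial_smul (n := 1) y
  have h3 (y : E) : p 2 (fun _ => y) = fderiv ℂ (fderiv ℂ f) 0 y y / 2 := by
    have := hp.factorial_smul (n := 2) y
    rw [iteratedFDeriv_two_apply] at this
    rw [← this]
    simp
  refine (h2.congr_left fun t => ?_).trans ?_
  · simp [FormalMultilinearSeries.partialSum, Finset.sum_range_succ, h0, h1, h3]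
    ring
  · refine IsBigO.of_bound (‖v‖ ^ 3) (Eventually.of_forall fun t => ?_)
    simp [norm_smul, mul_pow, mul_comm]

end Jet

section TotallyReal

variable {n : ℕ}

theorem exists_eq_add_I_smul (p : (Fin n → ℂ) × (Fin n → ℂ)) :
    ∃ a b : Fin n → ℂ, p = (a, star a) + Complex.I • (b, star b) ∧ ‖a‖ ≤ ‖p‖ ∧ ‖b‖ ≤ ‖p‖ := by
  have h1 : ‖p.1‖ ≤ ‖p‖ := norm_fst_le p
  have h2 : ‖star p.2‖ ≤ ‖p‖ := by rw [norm_star]; exact norm_snd_le p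
  refine ⟨(1 / 2 : ℂ) • (p.1 + star p.2), (-Complex.I / 2 : ℂ) • (p.1 - star p.2), ?_, ?_, ?_⟩
  · refine Prod.ext ?_ ?_ <;> funext i <;> simp [Complex.ext_iff] <;> constructor <;> ring
  · rw [norm_smul]
    have := norm_add_le p.1 (star p.2)
    norm_num
    linarith
  · rw [norm_smul]
    have := norm_sub_le p.1 (star p.2)
    norm_num
    linarith

theorem eventually_eq_zero_of_forall_star {F : (Fin n → ℂ) × (Fin n → ℂ) → ℂ}
    (hF : AnalyticAt ℂ F 0) (h : ∀ᶠ z : Fin n → ℂ in 𝓝 0, F (z, star z) = 0) :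
    ∀ᶠ p in 𝓝 0, F p = 0 := by
  obtain ⟨r, hr, hFr⟩ := Metric.eventually_nhds_iff_ball.1 hF.eventually_analyticAt
  obtain ⟨r', hr', hr0⟩ := Metric.eventually_nhds_iff_ball.1 h
  filter_upwards [Metric.ball_mem_nhds 0 (show 0 < min r r' / 3 by positivity)] with p hp
  rw [mem_ball_zero_iff] at hp
  obtain ⟨a, b, hpab, ha, hb⟩ := exists_eq_add_I_smul p
  have hnorm {t : ℂ} (ht : t ∈ Metric.ball (0 : ℂ) 2) {a b : Fin n → ℂ} (ha : ‖a‖ ≤ ‖p‖)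
      (hb : ‖b‖ ≤ ‖p‖) : ‖a + t • b‖ < min r r' := by
    rw [mem_ball_zero_iff] at ht
    calc ‖a + t • b‖ ≤ ‖a‖ + ‖t‖ * ‖b‖ := by rw [← norm_smul]; exact norm_add_le _ _
      _ ≤ ‖p‖ + 2 * ‖p‖ := by gcongr
      _ < min r r' := by linarith
  have han : AnalyticOnNhd ℂ (fun t : ℂ => F ((a, star a) + t • (b, star b)))
      (Metric.ball 0 2) := by
    intro t ht
    refine AnalyticAt.fun_comp (g := F) (hFr _ ?_) (by fun_prop)
    rw [mem_ball_zero_iff, Prod.norm_def, max_lt_iff]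
    exact ⟨(hnorm ht ha hb).trans_le (min_le_left _ _),
      (hnorm ht (by rwa [norm_star]) (by rwa [norm_star])).trans_le (min_le_left _ _)⟩
  have hfreq : ∃ᶠ t in 𝓝[≠] (0 : ℂ), F ((a, star a) + t • (b, star b)) = 0 := by
    have hlim : Tendsto (fun t : ℝ => (t : ℂ)) (𝓝[≠] 0) (𝓝[≠] 0) := by
      refine tendsto_nhdsWithin_iff.2 ⟨?_, ?_⟩
      · simpa using (Complex.continuous_ofReal.tendsto 0).mono_left nhdsWithin_le_nhds
      · filter_upwards [self_mem_nhdsWithin] with t ht using by simpa using ht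
    refine hlim.frequently (Eventually.frequently ?_)
    filter_upwards [nhdsWithin_le_nhds (Metric.ball_mem_nhds (0 : ℝ) two_pos)] with t ht
    have ht' : (t : ℂ) ∈ Metric.ball (0 : ℂ) 2 := by simpa using ht
    have h1 := hr0 (a + (t : ℂ) • b)
      (mem_ball_zero_iff.2 ((hnorm ht' ha hb).trans_le (min_le_right _ _)))
    rw [star_add, star_smul] at h1
    simpa using h1
  have := han.eqOn_zero_of_preconnected_of_frequently_eq_zero
    (convex_ball (0 : ℂ) 2).isPreconnected (Metric.mem_ball_self two_pos) hfreq
    (show Complex.I ∈ Metric.ball (0 : ℂ) 2 by simp)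
  rw [hpab]
  exact this

theorem tendsto_prodMk_star :
    Tendsto (fun z : Fin n → ℂ => (z, star z)) (𝓝 0) (𝓝 0) := by
  have : Continuous fun z : Fin n → ℂ => (z, star z) := by fun_prop
  simpa only [star_zero, Prod.mk_zero_zero] using this.tendsto 0

theorem smul_prodMk_star (t : ℝ) (z : Fin n → ℂ) :
    (t : ℂ) • (z, star z) = ((t : ℂ) • z, star ((t : ℂ) • z)) := by
  simp [star_smul]

theorem tendsto_ofReal_smul (z : Fin n → ℂ) : Tendsto (fun t : ℝ => (t : ℂ) • z) (𝓝 0) (𝓝 0) := by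
  have : Continuous fun t : ℝ => (t : ℂ) • z := by fun_prop
  simpa using this.tendsto 0

theorem im_eq_zero_of_forall_star {F : (Fin n → ℂ) × (Fin n → ℂ) → ℂ} (hF : AnalyticAt ℂ F 0)
    (h : ∀ᶠ z : Fin n → ℂ in 𝓝 0, (F (z, star z)).im = 0) (z : Fin n → ℂ) :
    (fderiv ℂ F 0 (z, star z)).im = 0 ∧
      (fderiv ℂ (fderiv ℂ F) 0 (z, star z) (z, star z)).im = 0 := by
  have h1 := isBigO_sub_taylor_two hF (z, star z)
  set b := fderiv ℂ F 0 (z, star z)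
  set c := fderiv ℂ (fderiv ℂ F) 0 (z, star z) (z, star z)
  have h2 : (fun t : ℝ => (((F 0).im : ℝ) : ℂ) + t * ((b.im : ℝ) : ℂ) +
      (t : ℂ) ^ 2 * (((c / 2).im : ℝ) : ℂ)) =O[𝓝 0] fun t => t ^ 3 := by
    refine IsBigO.trans (IsBigO.of_bound 1 ?_) h1
    filter_upwards [(tendsto_ofReal_smul z).eventually h] with t ht
    rw [smul_prodMk_star, one_mul]
    refine le_trans (le_of_eq ?_) (Complex.abs_im_le_norm _)
    rw [Complex.sub_im, ht, zero_sub, abs_neg, ← Real.norm_eq_abs, ← Complex.norm_real]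
    congr 1
    simp only [← Complex.ofReal_pow, Complex.add_im, Complex.im_ofReal_mul]
    push_cast
    rfl
  obtain ⟨-, hb, hc⟩ := eq_zero_of_quadratic_isBigO h2
  refine ⟨by exact_mod_cast hb, ?_⟩
  have hc' : (c / 2).im = 0 := by exact_mod_cast hc
  rw [show c / 2 = ((1 / 2 : ℝ) : ℂ) * c by push_cast; ring, Complex.im_ofReal_mul] at hc'
  linarith

theorem eq_zero_of_forall_apply_self {E : Type} [NormedAddCommGroup E] [NormedSpace ℂ E]
    {D : E →L[ℂ] E →L[ℂ] ℂ} (hD : ∀ v w, D v w = D w v) (h : ∀ v, D v v = 0) : D = 0 := by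
  ext v w
  have h1 := h (v + w)
  simp only [map_add, _root_.add_apply, h, hD w v] at h1
  simp only [_root_.zero_apply]
  linear_combination h1 / 2

theorem AnalyticAt.fderiv_fderiv_comm {E : Type} [NormedAddCommGroup E] [NormedSpace ℂ E]
    {f : E → ℂ} {p : E} (hf : AnalyticAt ℂ f p) (v w : E) :
    fderiv ℂ (fderiv ℂ f) p v w = fderiv ℂ (fderiv ℂ f) p w v :=
  (hf.contDiffAt (n := 2)).isSymmSndFDerivAt (by simp) v w

end TotallyReal

section Quadric

variable {n : ℕ}

theorem jet_two_of_isBigO_star {ρ q : (Fin n → ℂ) × (Fin n → ℂ) → ℂ} (hρ : AnalyticAt ℂ ρ 0)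
    (hq : AnalyticAt ℂ q 0) (hsmul : ∀ (t : ℂ) p, q (t • p) = t ^ 2 * q p)
    (h : (fun z : Fin n → ℂ => ρ (z, star z) - q (z, star z)) =O[𝓝 0] fun z => ‖z‖ ^ 3) :
    ρ 0 = 0 ∧ fderiv ℂ ρ 0 = 0 ∧
      ∀ v w, fderiv ℂ (fderiv ℂ ρ) 0 v w = q (v + w) - q v - q w := by
  have hjet (z : Fin n → ℂ) : ρ 0 = 0 ∧ fderiv ℂ ρ 0 (z, star z) = 0 ∧
      fderiv ℂ (fderiv ℂ ρ) 0 (z, star z) (z, star z) / 2 - q (z, star z) = 0 := by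
    refine eq_zero_of_quadratic_isBigO ?_
    have h1 := isBigO_sub_taylor_two hρ (z, star z)
    have h2 : (fun t : ℝ => ρ ((t : ℂ) • (z, star z)) - (t : ℂ) ^ 2 * q (z, star z))
        =O[𝓝 0] fun t => t ^ 3 := by
      refine ((h.comp_tendsto (tendsto_ofReal_smul z)).congr_left fun t => ?_).trans ?_
      · simp only [Function.comp_apply, ← smul_prodMk_star, hsmul]
      · refine IsBigO.of_bound (‖z‖ ^ 3) (Eventually.of_forall fun t => ?_)
        simp [norm_smul, mul_pow, mul_comm]
    refine (h2.sub h1).congr_left fun t => ?_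
    ring
  have hfd : fderiv ℂ ρ 0 = 0 := by
    refine ContinuousLinearMap.ext fun p => ?_
    obtain ⟨a, b, rfl, -, -⟩ := exists_eq_add_I_smul p
    rw [map_add, map_smul, (hjet a).2.1, (hjet b).2.1]
    simp
  refine ⟨(hjet 0).1, hfd, ?_⟩
  have hzero : ∀ᶠ p in 𝓝 (0 : (Fin n → ℂ) × (Fin n → ℂ)),
      fderiv ℂ (fderiv ℂ ρ) 0 p p / 2 - q p = 0 := by
    refine eventually_eq_zero_of_forall_star ?_ (Eventually.of_forall fun z => (hjet z).2.2)
    refine AnalyticAt.fun_sub ?_ hq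
    refine analyticAt_of_eventually_differentiableAt (Eventually.of_forall fun p => ?_)
    simp only [div_eq_mul_inv]
    fun_prop
  have hall (p) : fderiv ℂ (fderiv ℂ ρ) 0 p p = 2 * q p := by
    have hlim : Tendsto (fun t : ℂ => t • p) (𝓝[≠] 0) (𝓝 0) := by
      have : Continuous fun t : ℂ => t • p := by fun_prop
      simpa using (this.tendsto 0).mono_left (nhdsWithin_le_nhds (s := {0}ᶜ))
    obtain ⟨t, ht, ht0⟩ := ((hlim.eventually hzero).and self_mem_nhdsWithin).exists
    have ht0' : t ^ 2 ≠ 0 := pow_ne_zero 2 ht0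
    rw [hsmul, map_smul, map_smul, _root_.smul_apply, smul_eq_mul, smul_eq_mul] at ht
    refine mul_left_cancel₀ ht0' ?_
    linear_combination 2 * ht
  intro v w
  have h1 := hall (v + w)
  simp only [map_add, _root_.add_apply, hall, hρ.fderiv_fderiv_comm w v] at h1
  linear_combination h1 / 2

theorem jet_two_of_quadric {A B C : Matrix (Fin n) (Fin n) ℂ} (hB : B.IsSymm)
    {ρ : (Fin n → ℂ) × (Fin n → ℂ) → ℂ} (hρ : AnalyticAt ℂ ρ 0)
    (hE : (fun z : Fin n → ℂ => ρ (z, star z) -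
      (star z ⬝ᵥ A *ᵥ z + star (z ⬝ᵥ B *ᵥ z) + z ⬝ᵥ C *ᵥ z)) =O[𝓝 0] fun z => ‖z‖ ^ 3) :
    ρ 0 = 0 ∧ fderiv ℂ ρ 0 = 0 ∧ ∀ z ζ v : Fin n → ℂ, fderiv ℂ (fderiv ℂ ρ) 0 (z, ζ) (0, v) =
      v ⬝ᵥ A *ᵥ z + 2 * (v ⬝ᵥ B.map star *ᵥ ζ) := by
  have hq : AnalyticAt ℂ (fun p : (Fin n → ℂ) × (Fin n → ℂ) =>
      p.2 ⬝ᵥ A *ᵥ p.1 + p.2 ⬝ᵥ B.map star *ᵥ p.2 + p.1 ⬝ᵥ C *ᵥ p.1) 0 := by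
    refine analyticAt_of_eventually_differentiableAt (Eventually.of_forall fun p => ?_)
    simp only [mulVec, dotProduct]
    fun_prop
  obtain ⟨h0, h1, h2⟩ := jet_two_of_isBigO_star hρ hq
    (fun t p => by
      simp only [Prod.smul_fst, Prod.smul_snd, mulVec_smul, dotProduct_smul, smul_dotProduct,
        smul_eq_mul]
      ring)
    (hE.congr_left fun z => by
      congr 2
      congr 1
      simp [dotProduct, mulVec, Finset.mul_sum])
  refine ⟨h0, h1, fun z ζ v => ?_⟩
  have hsymm : ζ ⬝ᵥ B.map star *ᵥ v = v ⬝ᵥ B.map star *ᵥ ζ := by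
    rw [dotProduct_mulVec, ← mulVec_transpose, dotProduct_comm, hB.map star]
  rw [h2]
  simp only [Prod.fst_add, Prod.snd_add, add_zero, mulVec_add, dotProduct_add, add_dotProduct,
    mulVec_zero, dotProduct_zero, hsymm]
  ring

theorem exists_linearIndependent_fderiv_of_two_le_rank {A B : Matrix (Fin n) (Fin n) ℂ}
    (hB : B.IsSymm) (hrank : 2 ≤ (Matrix.fromRows Aᴴ B).rank)
    {D : (Fin n → ℂ) × (Fin n → ℂ) →L[ℂ] (Fin n → ℂ) × (Fin n → ℂ) →L[ℂ] ℂ}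
    (hD : ∀ z ζ v : Fin n → ℂ, D (z, ζ) (0, v) = v ⬝ᵥ A *ᵥ z + 2 * (v ⬝ᵥ B.map star *ᵥ ζ)) :
    ∃ v v' : Fin n → ℂ, LinearIndependent ℂ ![D.flip (0, v), D.flip (0, v')] := by
  have hrank' : 1 < Module.finrank ℂ (LinearMap.range (Matrix.fromRows Aᴴ B).mulVecLin) := hrank
  have : Nontrivial (LinearMap.range (Matrix.fromRows Aᴴ B).mulVecLin) :=
    Module.nontrivial_of_finrank_pos (R := ℂ) (by omega)
  obtain ⟨⟨_, x, rfl⟩, hx⟩ := exists_ne (0 : LinearMap.range (Matrix.fromRows Aᴴ B).mulVecLin)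
  obtain ⟨⟨_, y, rfl⟩, hxy⟩ := exists_linearIndependent_pair_of_one_lt_finrank hrank' hx
  rw [LinearIndependent.pair_iff] at hxy
  refine ⟨star x, star y, LinearIndependent.pair_iff.2 fun s t hst => ?_⟩
  set u : Fin n → ℂ := s • star x + t • star y with hu
  have hflip : D.flip (0, u) = 0 := by
    rw [← hst, ← map_smul, ← map_smul, ← map_add]
    simp [hu]
  have hDu (z ζ : Fin n → ℂ) : u ⬝ᵥ A *ᵥ z + 2 * (u ⬝ᵥ B.map star *ᵥ ζ) = 0 := by
    rw [← hD]
    simpa using DFunLike.congr_fun hflip (z, ζ)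
  have hA : Aᴴ *ᵥ star u = 0 := by
    rw [← star_vecMul, star_eq_zero]
    refine dotProduct_eq_zero _ fun z => ?_
    rw [← dotProduct_mulVec]
    simpa using hDu z 0
  have hBu : B *ᵥ star u = 0 := by
    have h1 : B = (B.map star)ᴴ := by
      ext i j
      simp [hB.apply i j]
    rw [h1, ← star_vecMul, star_eq_zero]
    refine dotProduct_eq_zero _ fun z => ?_
    rw [← dotProduct_mulVec]
    simpa using hDu 0 z
  have h2 := hxy (star s) (star t) (by
    refine Subtype.ext ?_
    have h3 : star u = star s • x + star t • y := by simp [hu]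
    change star s • (Matrix.fromRows Aᴴ B).mulVecLin x +
      star t • (Matrix.fromRows Aᴴ B).mulVecLin y = 0
    rw [← map_smul, ← map_smul, ← map_add, ← h3, mulVecLin_apply, fromRows_mulVec, hA, hBu]
    ext i
    cases i <;> rfl)
  simpa using h2

end Quadric

section ChainRule

theorem AnalyticAt.fderiv_fderiv_apply_const {E : Type} [NormedAddCommGroup E] [NormedSpace ℂ E]
    {f : E → ℂ} {p : E} (hf : AnalyticAt ℂ f p) (v : E) :
    fderiv ℂ (fun x => fderiv ℂ f x v) p = (fderiv ℂ (fderiv ℂ f) p).flip v := by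
  ext w
  rw [fderiv_clm_apply hf.fderiv.differentiableAt (differentiableAt_const _)]
  simp

theorem mul_comm_of_forall_single {n : ℕ} {a b : (Fin n → ℂ) →L[ℂ] ℂ}
    (h : ∀ k l : Fin n, a (Pi.single l 1) * b (Pi.single k 1) =
      a (Pi.single k 1) * b (Pi.single l 1)) (x y : Fin n → ℂ) : a y * b x = a x * b y := by
  have hsum (a : (Fin n → ℂ) →L[ℂ] ℂ) (x : Fin n → ℂ) : a x = ∑ i, x i * a (Pi.single i 1) := by
    conv_lhs => rw [pi_eq_sum_univ' x]
    simp
  rw [hsum a x, hsum a y, hsum b x, hsum b y, Finset.sum_mul_sum, Finset.sum_mul_sum,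
    Finset.sum_comm]
  refine Finset.sum_congr rfl fun i _ => Finset.sum_congr rfl fun j _ => ?_
  linear_combination x i * y j * h i j

variable {Z : Type} [NormedAddCommGroup Z] [NormedSpace ℂ Z] {h : Z × ℂ → ℂ} {ρ : Z × Z → ℂ}

theorem eventually_fderiv_comp_fst_prodMk (hh : AnalyticAt ℂ h 0) (hρ : AnalyticAt ℂ ρ 0)
    (hρ0 : ρ 0 = 0) : ∀ᶠ p in 𝓝 (0 : Z × Z), ∀ x, fderiv ℂ (fun p => h (p.1, ρ p)) p x =
      fderiv ℂ h (p.1, ρ p) (x.1, fderiv ℂ ρ p x) := by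
  have hc : Tendsto (fun p : Z × Z => (p.1, ρ p)) (𝓝 0) (𝓝 0) := by
    have h1 : ContinuousAt (fun p : Z × Z => (p.1, ρ p)) 0 :=
      continuousAt_fst.prodMk hρ.continuousAt
    simpa [ContinuousAt, hρ0, Prod.mk_zero_zero] using h1
  filter_upwards [hc.eventually hh.eventually_analyticAt, hρ.eventually_analyticAt] with p h1 h2 x
  have := h1.differentiableAt.hasFDerivAt.comp (f := fun p : Z × Z => (p.1, ρ p)) p
    (hasFDerivAt_fst.prodMk h2.differentiableAt.hasFDerivAt)
  change fderiv ℂ (h ∘ fun p : Z × Z => (p.1, ρ p)) p x = _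
  rw [this.fderiv]
  simp

theorem fderiv_comp_fst_prodMk (hh : AnalyticAt ℂ h 0) (hρ : AnalyticAt ℂ ρ 0) (hρ0 : ρ 0 = 0)
    (hρ1 : fderiv ℂ ρ 0 = 0) (x : Z × Z) :
    fderiv ℂ (fun p => h (p.1, ρ p)) 0 x = fderiv ℂ h 0 (x.1, 0) := by
  rw [(eventually_fderiv_comp_fst_prodMk hh hρ hρ0).self_of_nhds x, hρ1]
  simp [hρ0, Prod.mk_zero_zero]

theorem fderiv_fderiv_comp_fst_prodMk (hh : AnalyticAt ℂ h 0) (hρ : AnalyticAt ℂ ρ 0)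
    (hρ0 : ρ 0 = 0) (hρ1 : fderiv ℂ ρ 0 = 0) (x y : Z × Z) :
    fderiv ℂ (fderiv ℂ fun p => h (p.1, ρ p)) 0 x y =
      fderiv ℂ (fderiv ℂ h) 0 (x.1, 0) (y.1, 0) +
        fderiv ℂ h 0 (0, fderiv ℂ (fderiv ℂ ρ) 0 x y) := by
  have hπ0 : ((0 : Z × Z).1, ρ 0) = (0 : Z × ℂ) := by simp [hρ0]
  have hg : AnalyticAt ℂ (fun p => h (p.1, ρ p)) 0 :=
    AnalyticAt.fun_comp (g := h) (by rwa [hπ0]) (analyticAt_fst.prod hρ)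
  have h1 : (fun p => fderiv ℂ (fun p => h (p.1, ρ p)) p y) =ᶠ[𝓝 0]
      fun p => fderiv ℂ h (p.1, ρ p) (y.1, fderiv ℂ ρ p y) := by
    filter_upwards [eventually_fderiv_comp_fst_prodMk hh hρ hρ0] with p hp using hp y
  have h2 : HasFDerivAt (fun p : Z × Z => fderiv ℂ h (p.1, ρ p))
      ((fderiv ℂ (fderiv ℂ h) 0).comp ((ContinuousLinearMap.fst ℂ Z Z).prod (fderiv ℂ ρ 0))) 0 := by
    refine HasFDerivAt.comp (g := fderiv ℂ h) 0 ?_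
      (hasFDerivAt_fst.prodMk hρ.differentiableAt.hasFDerivAt)
    rw [hπ0]
    exact hh.fderiv.differentiableAt.hasFDerivAt
  have h3 : HasFDerivAt (fun p : Z × Z => (y.1, fderiv ℂ ρ p y))
      ((0 : Z × Z →L[ℂ] Z).prod ((fderiv ℂ (fderiv ℂ ρ) 0).flip y)) 0 := by
    refine (hasFDerivAt_const _ _).prodMk ?_
    rw [← hρ.fderiv_fderiv_apply_const]
    exact (hρ.fderiv_apply_const y).differentiableAt.hasFDerivAt
  have h4 := hg.fderiv_fderiv_apply_const y
  rw [h1.fderiv_eq, (h2.clm_apply h3).fderiv] at h4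
  have h5 := DFunLike.congr_fun h4 x
  simp [hρ0, hρ1, Prod.mk_zero_zero] at h5
  rw [← h5, add_comm]

end ChainRule

/-- **Corollary 6.1 (flattening).** With `M = {w = ρ(z,z̄)}` as in the main
theorem (rank condition on `[A*; B]`), `M` is flattenable (there is a
holomorphic function near `0` that is nonconstant, has nonvanishing derivative
on `M`, and is real-valued on `M`) iff the complex tangent bundle of `M` has a
real-valued nonconstant real-analytic first integral `g` (a CR function on `M`)
whose second-order derivatives at `0` do not all vanish.  Real-analytic
functions of `(z,z̄)` are encoded by holomorphic complexifications on
`ℂⁿ × ℂⁿ` evaluated at `ζ = z̄`; the second-order Taylor coefficients of `g` in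
`z` and `z̄` are the degree-2 coefficients of its complexification. -/
theorem stmt_18 (n : ℕ) (hn : 2 ≤ n)
    (A B C : Matrix (Fin n) (Fin n) ℂ) (hB : B.IsSymm) (hC : C.IsSymm)
    (hrank : 2 ≤ (Matrix.fromRows Aᴴ B).rank)
    (ρ : (Fin n → ℂ) × (Fin n → ℂ) → ℂ)
    (hρ : AnalyticAt ℂ ρ 0)
    (hE : (fun z : Fin n → ℂ =>
        ρ (z, star z) -
          (star z ⬝ᵥ A *ᵥ z + star (z ⬝ᵥ B *ᵥ z) + z ⬝ᵥ C *ᵥ z))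
      =O[𝓝 0] fun z : Fin n → ℂ => ‖z‖ ^ 3) :
    (∃ h : (Fin n → ℂ) × ℂ → ℂ, AnalyticAt ℂ h 0 ∧
      (¬ ∀ᶠ x : (Fin n → ℂ) × ℂ in 𝓝 0, h x = h 0) ∧
      (∀ᶠ z : Fin n → ℂ in 𝓝 0, fderiv ℂ h (z, ρ (z, star z)) ≠ 0) ∧
      (∀ᶠ z : Fin n → ℂ in 𝓝 0, (h (z, ρ (z, star z))).im = 0)) ↔
    (∃ g : (Fin n → ℂ) × (Fin n → ℂ) → ℂ, AnalyticAt ℂ g 0 ∧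
      (¬ ∀ᶠ z : Fin n → ℂ in 𝓝 0, g (z, star z) = g 0) ∧
      (∀ᶠ z : Fin n → ℂ in 𝓝 0, (g (z, star z)).im = 0) ∧
      (∀ᶠ z : Fin n → ℂ in 𝓝 0, ∀ k ℓ : Fin n,
        fderiv ℂ ρ (z, star z) (0, Pi.single ℓ 1) *
            fderiv ℂ g (z, star z) (0, Pi.single k 1) -
          fderiv ℂ ρ (z, star z) (0, Pi.single k 1) *
            fderiv ℂ g (z, star z) (0, Pi.single ℓ 1) = 0) ∧
      iteratedFDeriv ℂ 2 g 0 ≠ 0) := by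
  obtain ⟨hρ0, hρ1, hρ2⟩ := jet_two_of_quadric hB hρ hE
  obtain ⟨v, v', hli⟩ := exists_linearIndependent_fderiv_of_two_le_rank hB hrank hρ2
  have hπ0 : ((0 : (Fin n → ℂ) × (Fin n → ℂ)).1, ρ 0) = (0 : (Fin n → ℂ) × ℂ) := by simp [hρ0]
  have hflip (v : Fin n → ℂ) : fderiv ℂ (fun x => fderiv ℂ ρ x (0, v)) 0 =
      (fderiv ℂ (fderiv ℂ ρ) 0).flip (0, v) := hρ.fderiv_fderiv_apply_const (0, v)
  constructor
  · rintro ⟨h, hh, -, hdh, him⟩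
    have hg : AnalyticAt ℂ (fun p => h (p.1, ρ p)) 0 :=
      AnalyticAt.fun_comp (g := h) (by rwa [hπ0]) (analyticAt_fst.prod hρ)
    have hne : iteratedFDeriv ℂ 2 (fun p => h (p.1, ρ p)) 0 ≠ 0 := by
      intro h0
      have hD : fderiv ℂ (fderiv ℂ fun p => h (p.1, ρ p)) 0 = 0 := by
        refine ContinuousLinearMap.ext fun x => ContinuousLinearMap.ext fun y => ?_
        simpa [iteratedFDeriv_two_apply] using DFunLike.congr_fun h0 ![x, y]
      have hlin (z : Fin n → ℂ) : (fderiv ℂ h 0 (z, 0)).im = 0 := by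
        have := (im_eq_zero_of_forall_star hg him z).1
        rwa [fderiv_comp_fst_prodMk hh hρ hρ0 hρ1] at this
      have hlin0 (z : Fin n → ℂ) : fderiv ℂ h 0 (z, 0) = 0 := by
        refine Complex.ext ?_ (hlin z)
        have := hlin (Complex.I • z)
        rw [show (Complex.I • z, (0 : ℂ)) = Complex.I • (z, (0 : ℂ)) by simp, map_smul,
          smul_eq_mul, Complex.I_mul_im] at this
        exact this
      have hb : fderiv ℂ h 0 (0, 1) ≠ 0 := by
        intro hb
        have h1 : fderiv ℂ h (0, ρ (0, star 0)) ≠ 0 := hdh.self_of_nhds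
        rw [star_zero, Prod.mk_zero_zero, hρ0, Prod.mk_zero_zero] at h1
        refine h1 (ContinuousLinearMap.ext fun q => ?_)
        have h2 : q = (q.1, 0) + q.2 • ((0 : Fin n → ℂ), (1 : ℂ)) := by simp
        rw [h2, map_add, map_smul, hlin0, hb]
        simp
      refine hli.ne_zero 0 (ContinuousLinearMap.ext fun x => ?_)
      have h1 := fderiv_fderiv_comp_fst_prodMk hh hρ hρ0 hρ1 x (0, v)
      have hmul (c : ℂ) : fderiv ℂ h 0 (0, c) = c * fderiv ℂ h 0 (0, 1) := by
        rw [← smul_eq_mul, ← map_smul]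
        simp
      rw [hD, hmul] at h1
      simpa [hb, Prod.mk_zero_zero] using h1.symm
    refine ⟨fun p => h (p.1, ρ p), hg, fun hconst => hne ?_, him, ?_, hne⟩
    · have h1 : (fun p : (Fin n → ℂ) × (Fin n → ℂ) => h (p.1, ρ p)) =ᶠ[𝓝 0]
          fun _ => h ((0 : (Fin n → ℂ) × (Fin n → ℂ)).1, ρ 0) := by
        filter_upwards [eventually_eq_zero_of_forall_star
          (F := fun p => h (p.1, ρ p) - h ((0 : (Fin n → ℂ) × (Fin n → ℂ)).1, ρ 0))
          (hg.fun_sub analyticAt_const) (by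
            filter_upwards [hconst] with z hz using sub_eq_zero.2 hz)] with p hp
          using sub_eq_zero.1 hp
      ext m
      rw [iteratedFDeriv_two_apply, h1.fderiv.fderiv_eq]
      simp
    · filter_upwards [tendsto_prodMk_star.eventually (eventually_fderiv_comp_fst_prodMk hh hρ hρ0)]
        with z hz k l
      rw [hz, hz]
      have hmul (c : ℂ) : fderiv ℂ h (z, ρ (z, star z)) (0, c) =
          c * fderiv ℂ h (z, ρ (z, star z)) (0, 1) := by
        rw [← smul_eq_mul, ← map_smul]
        simp
      simp only
      rw [hmul, hmul (fderiv ℂ ρ (z, star z) (0, Pi.single l 1))]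
      ring
  · rintro ⟨g, hg, -, him, hCR, hne⟩
    have hCR' : ∀ᶠ p in 𝓝 (0 : (Fin n → ℂ) × (Fin n → ℂ)), ∀ k l : Fin n → ℂ,
        fderiv ℂ ρ p (0, l) * fderiv ℂ g p (0, k) = fderiv ℂ ρ p (0, k) * fderiv ℂ g p (0, l) := by
      have h1 : ∀ᶠ p in 𝓝 (0 : (Fin n → ℂ) × (Fin n → ℂ)), ∀ k l : Fin n,
          fderiv ℂ ρ p (0, Pi.single l 1) * fderiv ℂ g p (0, Pi.single k 1) -
            fderiv ℂ ρ p (0, Pi.single k 1) * fderiv ℂ g p (0, Pi.single l 1) = 0 := by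
        refine eventually_all.2 fun k => eventually_all.2 fun l =>
          eventually_eq_zero_of_forall_star ?_ ?_
        · exact ((hρ.fderiv_apply_const _).fun_mul (hg.fderiv_apply_const _)).fun_sub
            ((hρ.fderiv_apply_const _).fun_mul (hg.fderiv_apply_const _))
        · filter_upwards [hCR] with z hz using hz k l
      filter_upwards [h1] with p hp k l
      exact mul_comm_of_forall_single
        (a := (fderiv ℂ ρ p).comp (ContinuousLinearMap.inr ℂ (Fin n → ℂ) (Fin n → ℂ)))
        (b := (fderiv ℂ g p).comp (ContinuousLinearMap.inr ℂ (Fin n → ℂ) (Fin n → ℂ)))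
        (fun k l => by simpa using sub_eq_zero.1 (hp k l)) k l
    obtain ⟨h, hh, hgh⟩ := exists_analyticAt_eq_comp hρ hg hρ0
      (by rwa [hflip, hflip] : LinearIndependent ℂ ![fderiv ℂ (fun x => fderiv ℂ ρ x (0, v)) 0,
        fderiv ℂ (fun x => fderiv ℂ ρ x (0, v')) 0]) hCR'
    have hgh' : g =ᶠ[𝓝 0] fun p => h (p.1, ρ p) := hgh
    have hdh : fderiv ℂ h 0 ≠ 0 := by
      intro hdh
      have hD (x y : (Fin n → ℂ) × (Fin n → ℂ)) : fderiv ℂ (fderiv ℂ g) 0 x y =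
          fderiv ℂ (fderiv ℂ h) 0 (x.1, 0) (y.1, 0) := by
        rw [hgh'.fderiv.fderiv_eq, fderiv_fderiv_comp_fst_prodMk hh hρ hρ0 hρ1, hdh]
        simp
      have hs (z : Fin n → ℂ) : (fderiv ℂ (fderiv ℂ h) 0 (z, 0) (z, 0)).im = 0 := by
        have := (im_eq_zero_of_forall_star hg him z).2
        rwa [hD] at this
      obtain ⟨c, hc⟩ := IsAlgClosed.exists_pow_nat_eq Complex.I two_pos
      have hs0 (z : Fin n → ℂ) : fderiv ℂ (fderiv ℂ h) 0 (z, 0) (z, 0) = 0 := by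
        refine Complex.ext ?_ (hs z)
        have := hs (c • z)
        rw [show (c • z, (0 : ℂ)) = c • (z, (0 : ℂ)) by simp, map_smul, map_smul,
          _root_.smul_apply, smul_smul, ← sq, hc, smul_eq_mul, Complex.I_mul_im] at this
        exact this
      refine hne ?_
      ext m
      rw [iteratedFDeriv_two_apply, eq_zero_of_forall_apply_self hg.fderiv_fderiv_comm
        fun x => (hD x x).trans (hs0 x.1)]
      simp
    have hlim : Tendsto (fun z : Fin n → ℂ => (z, ρ (z, star z))) (𝓝 0) (𝓝 0) := by
      have h1 : ContinuousAt (fun p : (Fin n → ℂ) × (Fin n → ℂ) => (p.1, ρ p)) 0 :=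
        continuousAt_fst.prodMk hρ.continuousAt
      have h2 := h1.tendsto.comp tendsto_prodMk_star
      rwa [hπ0] at h2
    refine ⟨h, hh, fun hconst => hdh ?_, ?_, ?_⟩
    · rw [EventuallyEq.fderiv_eq (f := fun _ => h 0) hconst]
      simp
    · exact hlim.eventually (hh.fderiv.continuousAt.eventually_ne hdh)
    · filter_upwards [tendsto_prodMk_star.eventually hgh, him] with z hz hz'
      rwa [hz] at hz'
end
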